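/- arXiv:1012.2181 — 2 statements merged into one kernel-verified Lean document; each statement's English description precedes it below -/
import Mathlib

section
/- With N = p1^m and D_0 as in the context, let χ be the multiplicative character of F_q with χ(γ) = exp(2πi/N), let h be the class number of Q(√(−p1)), let h0 = (f−h)/2, and let b, c be integers with b, c ≢ 0 (mod p), b² + p1·c² = 4·p^h, b·p^{h0} ≡ −2 (mod p1), and g(conj(χ)) = ((b + c·i·√p1)/2)·p^{h0}. Then the Cayley graph Cay(F_q, D_0) is a strongly regular graph if and only if b, c ∈ {1, −1}. -/
open scoped Classical

noncomputable section

section CayleyGraph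

lemma sum_ite_mem_mul {F : Type*} [Fintype F] (D : Set F) (g : F → ℂ) :
    ∑ z, (if z ∈ D then (1 : ℂ) else 0) * g z = ∑ z ∈ D.toFinset, g z := by
  rw [← Finset.sum_filter_add_sum_filter_not Finset.univ (fun z => z ∈ D)]
  rw [Finset.sum_eq_zero (s := Finset.univ.filter (fun z => z ∉ D))]
  · rw [add_zero]
    refine Finset.sum_congr (by ext; simp) ?_
    intro x hx
    simp_all
  · intro x hx
    simp_all

variable {F : Type} [Field F]

lemma fromRel_sub_mem_adj {D : Set F} (h0 : 0 ∉ D) (hneg : ∀ x ∈ D, -x ∈ D) (v w : F) :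
    (SimpleGraph.fromRel (fun x y : F => x - y ∈ D)).Adj v w ↔ v - w ∈ D := by
  rw [SimpleGraph.fromRel_adj]
  constructor
  · rintro ⟨_, h | h⟩
    · exact h
    · simpa using hneg _ h
  · intro h
    refine ⟨?_, Or.inl h⟩
    rintro rfl
    simp [h0] at h

variable [Fintype F]

/-- The value at `y` of the Fourier transform of the indicator function of `D`. -/
def cayleyEigenvalue (ψ : AddChar F ℂ) (D : Set F) (y : F) : ℂ :=
  ∑ x ∈ D.toFinset, ψ (x * y)

/-- The number of ways to write `z` as a sum of two elements of `D`. -/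
def sumRepCount (D : Set F) (z : F) : ℕ :=
  (D.toFinset.filter (fun x => z - x ∈ D)).card

lemma sum_addChar_mul {ψ : AddChar F ℂ} (hψ : ψ.IsPrimitive) (b : F) :
    ∑ y, ψ (b * y) = if b = 0 then (Fintype.card F : ℂ) else 0 := by
  simp_rw [mul_comm b, AddChar.sum_mulShift b hψ]
  split_ifs <;> simp

lemma cayleyEigenvalue_sq (ψ : AddChar F ℂ) (D : Set F) (y : F) :
    cayleyEigenvalue ψ D y ^ 2 = ∑ z, (sumRepCount D z : ℂ) * ψ (z * y) := by
  have h1 : ∀ z, (sumRepCount D z : ℂ) =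
      ∑ x ∈ D.toFinset, if z - x ∈ D then (1 : ℂ) else 0 := by
    intro z
    simp [sumRepCount]
  simp_rw [h1, Finset.sum_mul]
  rw [Finset.sum_comm, sq, cayleyEigenvalue, Finset.sum_mul]
  refine Finset.sum_congr rfl fun x _ => ?_
  rw [← sum_ite_mem_mul, Finset.mul_sum]
  refine Fintype.sum_equiv (Equiv.addRight x) _ _ fun z => ?_
  simp only [Equiv.coe_addRight, add_sub_cancel_right, add_mul, AddChar.map_add_eq_mul]
  ring

lemma sum_cayleyEigenvalue_mul {ψ : AddChar F ℂ} (hψ : ψ.IsPrimitive) (D : Set F) (z : F) :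
    ∑ y, cayleyEigenvalue ψ D y * ψ (-z * y) =
      (if z ∈ D then 1 else 0) * (Fintype.card F : ℂ) := by
  simp_rw [cayleyEigenvalue, Finset.sum_mul, ← AddChar.map_add_eq_mul, ← add_mul]
  rw [Finset.sum_comm]
  simp_rw [sum_addChar_mul hψ, add_neg_eq_zero]
  by_cases h : z ∈ D <;> simp [h]

lemma sum_cayleyEigenvalue_sq_mul {ψ : AddChar F ℂ} (hψ : ψ.IsPrimitive) (D : Set F) (z : F) :
    ∑ y, cayleyEigenvalue ψ D y ^ 2 * ψ (-z * y) =
      (sumRepCount D z : ℂ) * (Fintype.card F : ℂ) := by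
  simp_rw [cayleyEigenvalue_sq, Finset.sum_mul]
  rw [Finset.sum_comm]
  simp_rw [mul_assoc, ← AddChar.map_add_eq_mul, ← add_mul, ← Finset.mul_sum]
  simp_rw [sum_addChar_mul hψ, add_neg_eq_zero]
  simp

lemma card_commonNeighbors_fromRel {D : Set F} (h0 : 0 ∉ D) (hneg : ∀ x ∈ D, -x ∈ D) (v w : F) :
    Fintype.card ((SimpleGraph.fromRel (fun x y : F => x - y ∈ D)).commonNeighbors v w) =
      sumRepCount D (v - w) := by
  rw [← Set.toFinset_card, sumRepCount]
  refine Finset.card_bij' (fun x _ => v - x) (fun x _ => v - x) ?_ ?_ ?_ ?_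
  · intro x hx
    simp only [Set.mem_toFinset, SimpleGraph.mem_commonNeighbors,
      fromRel_sub_mem_adj h0 hneg, Finset.mem_filter] at hx ⊢
    refine ⟨hx.1, ?_⟩
    convert hneg _ hx.2 using 1
    ring
  · intro x hx
    simp only [Set.mem_toFinset, SimpleGraph.mem_commonNeighbors,
      fromRel_sub_mem_adj h0 hneg, Finset.mem_filter] at hx ⊢
    refine ⟨by simpa using hx.1, ?_⟩
    convert hneg _ hx.2 using 1
    ring
  · intro x _
    simp
  · intro x _
    simp

lemma degree_fromRel {D : Set F} (h0 : 0 ∉ D) (hneg : ∀ x ∈ D, -x ∈ D) (v : F) :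
    (SimpleGraph.fromRel (fun x y : F => x - y ∈ D)).degree v = D.toFinset.card := by
  rw [← SimpleGraph.card_neighborFinset_eq_degree]
  refine Finset.card_bij' (fun x _ => v - x) (fun x _ => v - x) ?_ ?_ ?_ ?_
  · intro x hx
    simpa [fromRel_sub_mem_adj h0 hneg, -SimpleGraph.fromRel_adj] using hx
  · intro x hx
    simpa [fromRel_sub_mem_adj h0 hneg, -SimpleGraph.fromRel_adj] using hx
  · intro x _
    simp
  · intro x _
    simp

/-- The nontrivial eigenvalues of a strongly regular Cayley graph are roots of a common monic
quadratic polynomial. -/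
lemma exists_quadratic_of_isSRGWith {ψ : AddChar F ℂ} (hψ : ψ.IsPrimitive) {D : Set F}
    (h0 : 0 ∉ D) (hneg : ∀ x ∈ D, -x ∈ D) {q k l u : ℕ}
    (hG : (SimpleGraph.fromRel (fun x y : F => x - y ∈ D)).IsSRGWith q k l u) :
    ∃ s t : ℂ, ∀ y, y ≠ 0 →
      cayleyEigenvalue ψ D y ^ 2 = s * cayleyEigenvalue ψ D y + t := by
  obtain ⟨t, hl⟩ : ∃ t : ℂ, ∀ z, (sumRepCount D z : ℂ) =
      u + ((l : ℂ) - u) * (if z ∈ D then 1 else 0) + t * (if z = 0 then 1 else 0) := by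
    refine ⟨(sumRepCount D 0 : ℂ) - u, fun z => ?_⟩
    by_cases hz : z = 0
    · simp [hz, h0]
    · by_cases hD : z ∈ D
      · have := hG.of_adj z 0 (by rw [fromRel_sub_mem_adj h0 hneg]; simpa using hD)
        rw [card_commonNeighbors_fromRel h0 hneg, sub_zero] at this
        simp [hz, hD, this]
      · have := hG.of_not_adj (show z ≠ 0 from hz)
          (by rw [fromRel_sub_mem_adj h0 hneg]; simpa using hD)
        rw [card_commonNeighbors_fromRel h0 hneg, sub_zero] at this
        simp [hz, hD, this]
  refine ⟨(l : ℂ) - u, t, fun y hy => ?_⟩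
  rw [cayleyEigenvalue_sq]
  simp_rw [hl, add_mul, Finset.sum_add_distrib, mul_assoc, ← Finset.mul_sum]
  rw [AddChar.sum_mulShift _ hψ, sum_ite_mem_mul]
  simp [hy, cayleyEigenvalue]

/-- A Cayley graph whose nontrivial eigenvalues are roots of a common monic quadratic polynomial
is strongly regular. -/
lemma exists_isSRGWith_of_quadratic {ψ : AddChar F ℂ} (hψ : ψ.IsPrimitive) {D : Set F}
    (h0 : 0 ∉ D) (hneg : ∀ x ∈ D, -x ∈ D) {s t : ℂ}
    (hE : ∀ y, y ≠ 0 → cayleyEigenvalue ψ D y ^ 2 = s * cayleyEigenvalue ψ D y + t) :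
    ∃ k l u : ℕ,
      (SimpleGraph.fromRel (fun x y : F => x - y ∈ D)).IsSRGWith (Fintype.card F) k l u := by
  have hq : (Fintype.card F : ℂ) ≠ 0 := by simp
  have key : ∀ z, z ≠ 0 → (sumRepCount D z : ℂ) * (Fintype.card F : ℂ) =
      s * ((if z ∈ D then 1 else 0) * (Fintype.card F : ℂ)) +
      (cayleyEigenvalue ψ D 0 ^ 2 - s * cayleyEigenvalue ψ D 0 - t) := by
    intro z hz
    rw [← sum_cayleyEigenvalue_sq_mul hψ, ← sum_cayleyEigenvalue_mul hψ]
    have h1 : ∀ y, cayleyEigenvalue ψ D y ^ 2 * ψ (-z * y) =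
        s * (cayleyEigenvalue ψ D y * ψ (-z * y)) + t * ψ (y * (-z)) +
        (if y = 0 then cayleyEigenvalue ψ D 0 ^ 2 - s * cayleyEigenvalue ψ D 0 - t else 0) := by
      intro y
      by_cases hy : y = 0
      · subst hy
        simp
      · rw [hE y hy, if_neg hy, mul_comm y]
        ring
    simp_rw [h1, Finset.sum_add_distrib, ← Finset.mul_sum]
    rw [AddChar.sum_mulShift _ hψ]
    simp [hz]
  have hconst : ∀ z z', z ≠ 0 → z' ≠ 0 → (z ∈ D ↔ z' ∈ D) →
      sumRepCount D z = sumRepCount D z' := by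
    intro z z' hz hz' h
    have : (sumRepCount D z : ℂ) * (Fintype.card F : ℂ) =
        (sumRepCount D z' : ℂ) * (Fintype.card F : ℂ) := by
      rw [key z hz, key z' hz']
      simp only [h]
    exact_mod_cast mul_right_cancel₀ hq this
  have hex : ∀ p : Prop, ∃ c, ∀ z, z ≠ 0 → (z ∈ D ↔ p) → sumRepCount D z = c := by
    intro p
    by_cases h : ∃ z', z' ≠ 0 ∧ (z' ∈ D ↔ p)
    · obtain ⟨z', hz', h'⟩ := h
      exact ⟨_, fun z hz hzp => hconst z z' hz hz' (hzp.trans h'.symm)⟩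
    · exact ⟨0, fun z hz hzp => (h ⟨z, hz, hzp⟩).elim⟩
  obtain ⟨l, hl⟩ := hex True
  obtain ⟨u, hu⟩ := hex False
  refine ⟨D.toFinset.card, l, u, rfl, fun v => degree_fromRel h0 hneg v, ?_, ?_⟩
  · intro v w h
    have hne := h.ne
    rw [fromRel_sub_mem_adj h0 hneg] at h
    rw [card_commonNeighbors_fromRel h0 hneg]
    exact hl _ (sub_ne_zero.2 hne) (by simpa using h)
  · intro v w hne h
    rw [fromRel_sub_mem_adj h0 hneg] at h
    rw [card_commonNeighbors_fromRel h0 hneg]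
    exact hu _ (sub_ne_zero.2 hne) (by simpa using h)

end CayleyGraph

section PeriodicSum

lemma sum_range_mul_of_shift {R : Type*} [CommSemiring R] {f : ℕ → R} {d : ℕ} {w : R}
    (hf : ∀ j, f (j + d) = f j * w) (K : ℕ) :
    ∑ j ∈ Finset.range (d * K), f j =
      (∑ k ∈ Finset.range K, w ^ k) * ∑ j ∈ Finset.range d, f j := by
  have hshift : ∀ k j, f (d * k + j) = w ^ k * f j := by
    intro k
    induction k with
    | zero => simp
    | succ k ih =>
      intro j
      rw [show d * (k + 1) + j = d * k + j + d by ring, hf, ih]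
      ring
  induction K with
  | zero => simp
  | succ K ih =>
    rw [mul_add, mul_one, Finset.sum_range_add, ih, Finset.sum_range_succ, add_mul]
    simp_rw [hshift, Finset.mul_sum]

lemma geom_sum_of_pow_eq_one {w : ℂ} {n : ℕ} (hw : w ^ n = 1) :
    ∑ k ∈ Finset.range n, w ^ k = if w = 1 then (n : ℂ) else 0 := by
  split_ifs with h
  · simp [h]
  · rw [geom_sum_eq h, hw]
    simp

lemma sum_range_zmod {R : Type*} [AddCommMonoid R] (n : ℕ) [NeZero n] (g : ZMod n → R) :
    ∑ j ∈ Finset.range n, g (j : ZMod n) = ∑ r, g r := by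
  refine Finset.sum_bij' (fun j _ => (j : ZMod n)) (fun r _ => r.val) ?_ ?_ ?_ ?_ ?_
  · simp
  · intro r _
    simpa using r.val_lt
  · intro j hj
    exact ZMod.val_cast_of_lt (by simpa using hj)
  · simp
  · simp

lemma sum_periodic_mul_pow {p1 M : ℕ} [NeZero p1] {ζ : ℂ}
    (hζ : IsPrimitiveRoot ζ (p1 * M)) (hM : 0 < M) (hω : (ζ ^ M) ^ p1 = 1)
    (H : ZMod p1 → ℂ) (n : ℕ) :
    ∑ j ∈ Finset.range (p1 * M), H j * ζ ^ (j * n) =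
      if M ∣ n then (M : ℂ) * ∑ r, H r * AddChar.zmodChar p1 hω (((n / M : ℕ) : ZMod p1) * r)
      else 0 := by
  have hp1 : 0 < p1 := Nat.pos_of_neZero p1
  have hw : (ζ ^ (p1 * n)) ^ M = 1 := by
    rw [← pow_mul, mul_right_comm, pow_mul, hζ.pow_eq_one, one_pow]
  rw [sum_range_mul_of_shift (w := ζ ^ (p1 * n)) (by
    intro j
    rw [Nat.cast_add, ZMod.natCast_self, add_zero]
    ring), geom_sum_of_pow_eq_one hw]
  simp only [hζ.pow_eq_one_iff_dvd, Nat.mul_dvd_mul_iff_left hp1]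
  split_ifs with h
  · obtain ⟨k, rfl⟩ := h
    rw [Nat.mul_div_cancel_left _ hM, ← sum_range_zmod p1]
    congr 1
    refine Finset.sum_congr rfl fun j _ => ?_
    rw [← Nat.cast_mul, AddChar.zmodChar_apply', ← pow_mul]
    ring_nf
  · simp

lemma exists_unique_dvd_add (M a : ℕ) (hM : 0 < M) :
    ∃ i < M, M ∣ a + i ∧ ∀ i' < M, M ∣ a + i' → i' = i := by
  have hd : M ∣ a + (M - a % M) % M := by
    have h3 := Nat.mod_lt a hM
    have h4 := Nat.div_add_mod a M
    have h5 : a + (M - a % M) = M * (a / M + 1) := by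
      rw [mul_add]
      omega
    rw [Nat.dvd_iff_mod_eq_zero, Nat.add_mod_mod, h5, Nat.mul_mod_right]
  refine ⟨(M - a % M) % M, Nat.mod_lt _ hM, hd, fun i hi hid => ?_⟩
  have h6 := Nat.ModEq.add_left_cancel' a
    ((Nat.modEq_zero_iff_dvd.2 hid).trans (Nat.modEq_zero_iff_dvd.2 hd).symm)
  rwa [Nat.ModEq, Nat.mod_eq_of_lt hi, Nat.mod_mod] at h6

end PeriodicSum

section QuadraticSum

variable {p1 : ℕ} [Fact p1.Prime]

/-- The complex-valued quadratic character of `ZMod p1`. -/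
def complexQuadraticChar (p1 : ℕ) [Fact p1.Prime] : MulChar (ZMod p1) ℂ :=
  (quadraticChar (ZMod p1)).ringHomComp (Int.castRingHom ℂ)

lemma complexQuadraticChar_apply (r : ZMod p1) :
    complexQuadraticChar p1 r = (quadraticChar (ZMod p1) r : ℂ) := rfl

lemma quadraticChar_neg_one_of_mod_four (h3 : p1 % 4 = 3) :
    quadraticChar (ZMod p1) (-1) = -1 := by
  rw [quadraticChar_neg_one (by rw [ZMod.ringChar_zmod_n]; omega), ZMod.card,
    ZMod.χ₄_nat_three_mod_four h3]

lemma complexQuadraticChar_ne_one (h3 : p1 % 4 = 3) : complexQuadraticChar p1 ≠ 1 := by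
  intro h
  have h1 := congrArg (fun c : MulChar (ZMod p1) ℂ => c (-1)) h
  simp only [complexQuadraticChar_apply, quadraticChar_neg_one_of_mod_four h3] at h1
  rw [MulChar.one_apply (by simp)] at h1
  norm_num at h1

lemma complexQuadraticChar_gaussSum_sq (h3 : p1 % 4 = 3) {θ : AddChar (ZMod p1) ℂ}
    (hθ : θ.IsPrimitive) : gaussSum (complexQuadraticChar p1) θ ^ 2 = -(p1 : ℂ) := by
  rw [gaussSum_sq (χ := complexQuadraticChar p1) (complexQuadraticChar_ne_one h3)
    ((quadraticChar_isQuadratic _).comp _) hθ, complexQuadraticChar_apply,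
    quadraticChar_neg_one_of_mod_four h3]
  simp

lemma sum_sq_add_complexQuadraticChar (h3 : p1 % 4 = 3) {θ : AddChar (ZMod p1) ℂ}
    (hθ : θ.IsPrimitive) (A B : ℂ) (n : ZMod p1) :
    ∑ r, (A * complexQuadraticChar p1 r ^ 2 + B * complexQuadraticChar p1 r) * θ (n * r) =
      A * ((if n = 0 then (p1 : ℂ) else 0) - 1) +
        B * complexQuadraticChar p1 n * gaussSum (complexQuadraticChar p1) θ := by
  set c := complexQuadraticChar p1 with hc
  have hsq : ∀ r, c r ^ 2 = 1 - if r = 0 then 1 else 0 := by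
    intro r
    by_cases hr : r = 0
    · rw [hr, MulChar.map_zero]
      simp
    · have := quadraticChar_sq_one hr
      rw [hc, complexQuadraticChar_apply]
      simp only [hr, if_false, sub_zero]
      exact_mod_cast this
  have h1 : ∑ r, c r * θ (n * r) = c n * gaussSum c θ := by
    by_cases hn : n = 0
    · subst hn
      simp only [zero_mul, AddChar.map_zero_eq_one, mul_one]
      rw [MulChar.map_zero, zero_mul]
      exact MulChar.sum_eq_zero_of_ne_one (complexQuadraticChar_ne_one h3)
    · have h2 := gaussSum_mulShift c θ (Units.mk0 n hn)
      have hn2 : c n ^ 2 = 1 := by simp [hsq, hn]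
      simp only [Units.val_mk0] at h2
      rw [← h2, ← mul_assoc, ← sq, hn2, one_mul]
      simp [gaussSum, AddChar.mulShift_apply]
  have h2 : ∑ r, c r ^ 2 * θ (n * r) = (if n = 0 then (p1 : ℂ) else 0) - 1 := by
    simp_rw [hsq, sub_mul, Finset.sum_sub_distrib, one_mul, sum_addChar_mul hθ]
    simp
  simp_rw [add_mul, Finset.sum_add_distrib, mul_assoc, ← Finset.mul_sum, h1, h2]

end QuadraticSum

section CharacterExpansion

lemma _root_.IsPrimitiveRoot.pow_eq_pow_iff_mod_eq {ζ : ℂ} {N : ℕ} (hζ : IsPrimitiveRoot ζ N)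
    (hN : 0 < N) (i j : ℕ) : ζ ^ i = ζ ^ j ↔ i % N = j % N := by
  rw [pow_eq_pow_mod i hζ.pow_eq_one, pow_eq_pow_mod j hζ.pow_eq_one]
  exact ⟨hζ.pow_inj (Nat.mod_lt _ hN) (Nat.mod_lt _ hN), fun h => by rw [h]⟩

lemma double_sum_eq {p1 M : ℕ} [Fact p1.Prime] (h3 : p1 % 4 = 3) (hM : 0 < M) {ζ : ℂ}
    (hζ : IsPrimitiveRoot ζ (p1 * M)) (hω : IsPrimitiveRoot (ζ ^ M) p1) {G : ℕ → ℂ} {A B : ℂ}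
    (hG0 : G 0 = -1) (hG : ∀ j, ¬ p1 ∣ j → G j = A + B * complexQuadraticChar p1 j)
    {a i n : ℕ} (hi : i < M) (hin : a + i = M * n) :
    ∑ j ∈ Finset.range (p1 * M), (∑ i ∈ Finset.range M, ζ ^ (i * j)) * G j * ζ ^ (a * j) =
      M * (-1 + A * ((if (n : ZMod p1) = 0 then (p1 : ℂ) else 0) - 1) +
        B * complexQuadraticChar p1 n *
          gaussSum (complexQuadraticChar p1) (AddChar.zmodChar p1 hω.pow_eq_one)) := by
  have hp1 : p1.Prime := Fact.out
  have hN : 0 < p1 * M := Nat.mul_pos hp1.pos hM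
  set H : ZMod p1 → ℂ := fun r =>
    A * complexQuadraticChar p1 r ^ 2 + B * complexQuadraticChar p1 r with hH
  have hGH : ∀ j ∈ Finset.range (p1 * M),
      (∑ i ∈ Finset.range M, ζ ^ (i * j)) * G j * ζ ^ (a * j) =
        ∑ i ∈ Finset.range M, H j * ζ ^ (j * (a + i)) - if j = 0 then (M : ℂ) else 0 := by
    intro j hj
    have hfactor : ∑ i ∈ Finset.range M, H j * ζ ^ (j * (a + i)) =
        (∑ i ∈ Finset.range M, ζ ^ (i * j)) * H j * ζ ^ (a * j) := by
      rw [Finset.sum_mul, Finset.sum_mul]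
      refine Finset.sum_congr rfl fun i _ => ?_
      ring
    rw [hfactor]
    by_cases hdvd : p1 ∣ j
    · have hj0 : (j : ZMod p1) = 0 := (ZMod.natCast_eq_zero_iff _ _).2 hdvd
      have hHj : H j = 0 := by
        simp only [hH, hj0, MulChar.map_zero]
        ring
      by_cases hj : j = 0
      · subst hj
        rw [hHj, hG0]
        simp
      · have hgeom : ∑ i ∈ Finset.range M, ζ ^ (i * j) = 0 := by
          have h1 : (ζ ^ j) ^ M = 1 := by
            rw [← pow_mul, hζ.pow_eq_one_iff_dvd]
            exact Nat.mul_dvd_mul_right hdvd M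
          have h2 := geom_sum_of_pow_eq_one h1
          rw [if_neg] at h2
          · rw [← h2]
            refine Finset.sum_congr rfl fun i _ => ?_
            rw [mul_comm, pow_mul]
          · rw [hζ.pow_eq_one_iff_dvd]
            intro h
            exact absurd (Nat.le_of_dvd (Nat.pos_of_ne_zero hj) h)
              (by simpa using Finset.mem_range.1 ‹_›)
        simp [hgeom, hj]
    · have hj0 : (j : ZMod p1) ≠ 0 := by rwa [Ne, ZMod.natCast_eq_zero_iff]
      have hne : j ≠ 0 := by
        rintro rfl
        simp at hdvd
      have hc : complexQuadraticChar p1 (j : ZMod p1) ^ 2 = 1 := by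
        have := quadraticChar_sq_one hj0
        rw [complexQuadraticChar_apply]
        exact_mod_cast this
      rw [hG j hdvd]
      simp [hH, hc, hne]
  rw [Finset.sum_congr rfl hGH, Finset.sum_sub_distrib, Finset.sum_comm,
    Finset.sum_congr rfl fun i _ => sum_periodic_mul_pow hζ hM hω.pow_eq_one H (a + i),
    Finset.sum_eq_single i]
  · rw [if_pos ⟨n, hin⟩, hin, Nat.mul_div_cancel_left _ hM,
      sum_sq_add_complexQuadraticChar h3 (AddChar.zmodChar_primitive_of_primitive_root p1 hω)]
    rw [Finset.sum_ite_eq', if_pos (Finset.mem_range.2 hN)]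
    ring
  · intro i' hi' hne
    rw [if_neg]
    intro hd
    obtain ⟨i₀, -, -, h0⟩ := exists_unique_dvd_add M a hM
    exact hne ((h0 i' (by simpa using hi') hd).trans (h0 i hi ⟨n, hin⟩).symm)
  · intro h
    simp [hi] at h

variable {F : Type} [Field F] {γ : F} {N M : ℕ} {χ : MulChar F ℂ} {ζ : ℂ} {D : Set F}

lemma indicator_eq_sum_mulChar (hγ0 : γ ≠ 0) (hγ : ∀ x : F, x ≠ 0 → ∃ k : ℕ, x = γ ^ k)
    (hN : 0 < N) (hMN : M ≤ N) (hζ : IsPrimitiveRoot ζ N) (hχ : χ γ = ζ)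
    (hD : D = {x : F | ∃ i < M, ∃ t : ℕ, x = γ ^ (i + N * t)}) (x : F) :
    (if x ∈ D then 1 else 0) * (N : ℂ) =
      ∑ j ∈ Finset.range N, (∑ i ∈ Finset.range M, ζ ^ (i * j)) * (χ⁻¹ ^ j) x := by
  by_cases hx : x = 0
  · subst hx
    have h0 : (0 : F) ∉ D := by
      rw [hD]
      rintro ⟨i, _, t, h⟩
      exact pow_ne_zero _ hγ0 h.symm
    simp only [h0, if_false, zero_mul, MulChar.map_zero, mul_zero, Finset.sum_const_zero]
  · obtain ⟨k, rfl⟩ := hγ x hx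
    have hζ0 : ζ ≠ 0 := hζ.ne_zero hN.ne'
    have hmem : γ ^ k ∈ D ↔ k % N < M := by
      rw [hD]
      constructor
      · rintro ⟨i, hi, t, h⟩
        have h1 : ζ ^ k = ζ ^ i := by
          have h2 := congrArg χ h
          rwa [map_pow, map_pow, hχ, pow_add, pow_mul, hζ.pow_eq_one, one_pow, mul_one] at h2
        rw [hζ.pow_eq_pow_iff_mod_eq hN, Nat.mod_eq_of_lt (hi.trans_le hMN)] at h1
        omega
      · intro h
        exact ⟨_, h, k / N, by rw [Nat.mod_add_div]⟩
    have hχx : ∀ j, (χ⁻¹ ^ j) (γ ^ k) = (ζ ^ k)⁻¹ ^ j := by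
      intro j
      have := MulChar.pow_apply_coe χ⁻¹ j (Units.mk0 (γ ^ k) hx)
      rw [Units.val_mk0] at this
      rw [this, MulChar.inv_apply_eq_inv', map_pow, hχ]
    simp_rw [hχx, Finset.sum_mul]
    rw [Finset.sum_comm]
    have hinner : ∀ i ∈ Finset.range M, ∑ j ∈ Finset.range N, ζ ^ (i * j) * (ζ ^ k)⁻¹ ^ j =
        if i = k % N then (N : ℂ) else 0 := by
      intro i hi
      simp_rw [pow_mul, ← mul_pow]
      rw [geom_sum_of_pow_eq_one]
      · have hiff : ζ ^ i * (ζ ^ k)⁻¹ = 1 ↔ i = k % N := by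
          rw [mul_inv_eq_one₀ (pow_ne_zero _ hζ0), hζ.pow_eq_pow_iff_mod_eq hN,
            Nat.mod_eq_of_lt ((Finset.mem_range.1 hi).trans_le hMN)]
        simp only [hiff]
      · rw [mul_pow, inv_pow, pow_right_comm, pow_right_comm ζ k N, hζ.pow_eq_one]
        simp
    rw [Finset.sum_congr rfl hinner, Finset.sum_ite_eq']
    simp only [hmem, Finset.mem_range]
    split_ifs <;> simp

variable [Fintype F]

lemma cayleyEigenvalue_mul_eq_sum_gaussSum (hγ0 : γ ≠ 0)
    (hγ : ∀ x : F, x ≠ 0 → ∃ k : ℕ, x = γ ^ k)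
    (hN : 0 < N) (hMN : M ≤ N) (hζ : IsPrimitiveRoot ζ N) (hχ : χ γ = ζ)
    (hD : D = {x : F | ∃ i < M, ∃ t : ℕ, x = γ ^ (i + N * t)}) (ψ : AddChar F ℂ) (a : ℕ) :
    cayleyEigenvalue ψ D (γ ^ a) * N =
      ∑ j ∈ Finset.range N, (∑ i ∈ Finset.range M, ζ ^ (i * j)) * gaussSum (χ⁻¹ ^ j) ψ *
        ζ ^ (a * j) := by
  rw [cayleyEigenvalue, ← sum_ite_mem_mul, Finset.sum_mul]
  have h1 : ∀ x : F, (if x ∈ D then (1 : ℂ) else 0) * ψ (x * γ ^ a) * N =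
      ∑ j ∈ Finset.range N, (∑ i ∈ Finset.range M, ζ ^ (i * j)) *
        ((χ⁻¹ ^ j) x * ψ.mulShift (γ ^ a) x) := by
    intro x
    rw [mul_right_comm, indicator_eq_sum_mulChar hγ0 hγ hN hMN hζ hχ hD, Finset.sum_mul]
    refine Finset.sum_congr rfl fun j _ => ?_
    rw [AddChar.mulShift_apply, mul_comm x, mul_assoc]
  simp_rw [h1]
  rw [Finset.sum_comm]
  simp_rw [← Finset.mul_sum]
  refine Finset.sum_congr rfl fun j _ => ?_
  have h2 := gaussSum_mulShift_eq (χ⁻¹ ^ j) ψ (Units.mk0 (γ ^ a) (pow_ne_zero _ hγ0))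
  rw [← inv_pow, inv_inv, MulChar.pow_apply_coe, Units.val_mk0, map_pow, hχ] at h2
  rw [← gaussSum, h2]
  ring

end CharacterExpansion

section IndexTwo

/-- If `p` generates a subgroup of index two in the units modulo `p1 ^ m`, then `p` is a square
modulo `p1`, and up to sign every unit is a power of `p`; the sign is the quadratic character. -/
lemma exists_pow_eq_of_index_two {p1 m p : ℕ} [Fact p1.Prime] (h3 : p1 % 4 = 3) (hm : 1 ≤ m)
    (hcop : Nat.Coprime p (p1 ^ m))
    (hf2 : 2 * orderOf (p : ZMod (p1 ^ m)) = (p1 ^ m).totient) {j : ℕ} (hj : ¬ p1 ∣ j) :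
    (quadraticChar (ZMod p1) j = 1 ∧ ∃ k : ℕ, ((p ^ k : ℕ) : ZMod (p1 ^ m)) = j) ∨
    (quadraticChar (ZMod p1) j = -1 ∧ ∃ k : ℕ, ((p ^ k : ℕ) : ZMod (p1 ^ m)) = -j) := by
  have hp1 : p1.Prime := Fact.out
  have : NeZero (p1 ^ m) := ⟨pow_ne_zero _ hp1.ne_zero⟩
  set P := ZMod.unitOfCoprime p hcop with hP
  set J := ZMod.unitOfCoprime j (((Nat.Prime.coprime_iff_not_dvd hp1).2 hj).symm.pow_right m)
    with hJ
  have hPval : (P : ZMod (p1 ^ m)) = p := ZMod.coe_unitOfCoprime _ _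
  have hJval : (J : ZMod (p1 ^ m)) = j := ZMod.coe_unitOfCoprime _ _
  set f := orderOf (p : ZMod (p1 ^ m)) with hf
  have hordP : orderOf P = f := by rw [hf, ← hPval, orderOf_units]
  have hindex : (Subgroup.zpowers P).index = 2 := by
    have h1 := Subgroup.card_mul_index (Subgroup.zpowers P)
    rw [Nat.card_zpowers, hordP, Nat.card_eq_fintype_card, ZMod.card_units_eq_totient, ← hf2,
      mul_comm] at h1
    have hpos : 0 < f := by
      have := Nat.totient_pos.2 (NeZero.pos (p1 ^ m))
      omega
    exact Nat.eq_of_mul_eq_mul_right hpos h1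
  have hodd : Odd f := by
    rw [Nat.totient_prime_pow hp1 hm] at hf2
    have h1 : p1 - 1 = 2 * (2 * (p1 / 4) + 1) := by omega
    rw [h1] at hf2
    have h2 : f = p1 ^ (m - 1) * (2 * (p1 / 4) + 1) := by linarith
    rw [h2]
    refine (Odd.pow ?_).mul ⟨_, rfl⟩
    exact ⟨p1 / 2, by omega⟩
  let c : ZMod (p1 ^ m) →* ℤ :=
    (quadraticChar (ZMod p1)).toMonoidHom.comp
      (ZMod.castHom (dvd_pow_self p1 (by omega : m ≠ 0)) (ZMod p1)).toMonoidHom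
  have hcnat : ∀ n : ℕ, c n = quadraticChar (ZMod p1) n := by
    intro n
    simp [c]
  have hcneg : c (-1) = -1 := by
    change quadraticChar (ZMod p1) (ZMod.castHom _ (ZMod p1) (-1)) = -1
    rw [map_neg, map_one, quadraticChar_neg_one_of_mod_four h3]
  have hcp : c p = 1 := by
    have h1 : c p ^ f = 1 := by rw [← map_pow, hf, pow_orderOf_eq_one, map_one]
    exact hodd.strictMono_pow.injective (by simpa using h1)
  have hmem : ∀ u ∈ Subgroup.zpowers P, c (u : ZMod (p1 ^ m)) = 1 ∧
      ∃ k : ℕ, ((p ^ k : ℕ) : ZMod (p1 ^ m)) = u := by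
    intro u hu
    rw [← mem_powers_iff_mem_zpowers] at hu
    obtain ⟨k, rfl⟩ := hu
    have h1 : ((P ^ k : (ZMod (p1 ^ m))ˣ) : ZMod (p1 ^ m)) = (p : ZMod (p1 ^ m)) ^ k := by
      rw [Units.val_pow_eq_pow_val, hPval]
    refine ⟨?_, k, ?_⟩
    · rw [h1, map_pow, hcp, one_pow]
    · rw [h1, Nat.cast_pow]
  have hneg : (-1 : (ZMod (p1 ^ m))ˣ) ∉ Subgroup.zpowers P := by
    intro h
    have h1 := (hmem _ h).1
    rw [Units.val_neg, Units.val_one, hcneg] at h1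
    norm_num at h1
  by_cases hJmem : J ∈ Subgroup.zpowers P
  · obtain ⟨h1, h2⟩ := hmem _ hJmem
    rw [hJval] at h1 h2
    exact Or.inl ⟨by rw [← hcnat, h1], h2⟩
  · have h0 : -1 * J ∈ Subgroup.zpowers P :=
      (Subgroup.mul_mem_iff_of_index_two hindex).2 (by simp [hneg, hJmem])
    obtain ⟨h1, h2⟩ := hmem _ h0
    rw [Units.val_mul, Units.val_neg, Units.val_one, hJval] at h1 h2
    rw [map_mul, hcneg, hcnat] at h1
    exact Or.inr ⟨by linarith, by simpa using h2⟩

end IndexTwo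

section GaussSums

variable {F : Type} [Field F]

lemma mulChar_neg_one_of_pow_odd_eq_one {χ : MulChar F ℂ} {N : ℕ} (hN : Odd N)
    (hχ : χ ^ N = 1) : χ (-1) = 1 := by
  have h1 : χ (-1) ^ N = 1 := by
    rw [← MulChar.pow_apply' χ hN.pos.ne', hχ, MulChar.one_apply (by simp)]
  have h2 : χ (-1) ^ 2 = 1 := by rw [← map_pow]; simp
  obtain ⟨k, rfl⟩ := hN
  rwa [pow_succ, pow_mul, h2, one_pow, one_mul] at h1

/-- The additive character `x ↦ exp (2πi Tr(x) / p)`. -/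
def traceAddChar (p : ℕ) [Fact p.Prime] (F : Type) [Field F] [Algebra (ZMod p) F] :
    AddChar F ℂ :=
  ZMod.stdAddChar.compAddMonoidHom (Algebra.trace (ZMod p) F).toAddMonoidHom

variable {p : ℕ} [Fact p.Prime] [Algebra (ZMod p) F]

lemma traceAddChar_apply (x : F) : traceAddChar p F x =
    Complex.exp (2 * (Real.pi : ℂ) * Complex.I *
      ((Algebra.trace (ZMod p) F x).val : ℂ) / (p : ℂ)) := by
  have h := ZMod.stdAddChar_coe (N := p) ((Algebra.trace (ZMod p) F x).val : ℤ)
  push_cast at h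
  rw [ZMod.natCast_zmod_val] at h
  exact h

variable [Fintype F]

lemma traceAddChar_ne_one : traceAddChar p F ≠ 1 := by
  have : Module.Finite (ZMod p) F := Module.Finite.of_finite
  obtain ⟨x, hx⟩ := Algebra.trace_surjective (ZMod p) F 1
  intro h
  have h1 : ZMod.stdAddChar (1 : ZMod p) = (1 : ℂ) := by
    rw [← hx]
    exact congrArg (fun ψ : AddChar F ℂ => ψ x) h
  rw [← AddChar.map_zero_eq_one (ZMod.stdAddChar (N := p))] at h1
  exact one_ne_zero (ZMod.injective_stdAddChar h1)

lemma traceAddChar_pow_char (x : F) : traceAddChar p F (x ^ p) = traceAddChar p F x := by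
  have : Module.Finite (ZMod p) F := Module.Finite.of_finite
  have h := Algebra.trace_eq_of_algEquiv
    (FiniteField.frobeniusAlgEquivOfAlgebraic (ZMod p) F) x
  rw [FiniteField.coe_frobeniusAlgEquivOfAlgebraic, ZMod.card] at h
  exact congrArg ZMod.stdAddChar h

lemma gaussSum_pow_char (χ : MulChar F ℂ) :
    gaussSum (χ ^ p) (traceAddChar p F) = gaussSum χ (traceAddChar p F) := by
  have hp0 : p ≠ 0 := (Fact.out : p.Prime).ne_zero
  have : Module.Finite (ZMod p) F := Module.Finite.of_finite
  refine Fintype.sum_equiv (FiniteField.frobeniusAlgEquivOfAlgebraic (ZMod p) F).toEquiv _ _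
    fun x => ?_
  have h : (FiniteField.frobeniusAlgEquivOfAlgebraic (ZMod p) F).toEquiv x = x ^ p := by
    simp [ZMod.card]
  rw [h, traceAddChar_pow_char, MulChar.pow_apply' _ hp0, map_pow]

lemma gaussSum_pow_char_pow (χ : MulChar F ℂ) (k : ℕ) :
    gaussSum (χ ^ p ^ k) (traceAddChar p F) = gaussSum χ (traceAddChar p F) := by
  induction k with
  | zero => simp
  | succ k ih => rw [pow_succ, pow_mul, gaussSum_pow_char, ih]

lemma gaussSum_inv_eq_star {χ : MulChar F ℂ} (hχ : χ (-1) = 1) (ψ : AddChar F ℂ) :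
    gaussSum χ⁻¹ ψ = star (gaussSum χ ψ) := by
  rw [star_gaussSum_eq, ← mul_gaussSum_inv_eq_gaussSum, MulChar.inv_apply_eq_inv', hχ, inv_one,
    one_mul]

/-- Index-two Gauss sums: all Gauss sums of faithful powers of `χ` are conjugate to the first. -/
lemma gaussSum_pow_eq {p1 m : ℕ} [Fact p1.Prime] (h3 : p1 % 4 = 3) (hm : 1 ≤ m)
    (hcop : Nat.Coprime p (p1 ^ m))
    (hf2 : 2 * orderOf (p : ZMod (p1 ^ m)) = (p1 ^ m).totient) {χ : MulChar F ℂ}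
    (hχ : χ ^ p1 ^ m = 1) {A B : ℂ} (hA : star A = A) (hB : star B = -B)
    (hg : gaussSum χ (traceAddChar p F) = A + B) {j : ℕ} (hj : ¬ p1 ∣ j) :
    gaussSum (χ ^ j) (traceAddChar p F) = A + B * complexQuadraticChar p1 j := by
  rw [complexQuadraticChar_apply]
  rcases exists_pow_eq_of_index_two h3 hm hcop hf2 hj with ⟨h1, k, hk⟩ | ⟨h1, k, hk⟩
  · rw [h1]
    rw [ZMod.natCast_eq_natCast_iff] at hk
    have h2 : χ ^ p ^ k = χ ^ j := by
      rw [← pow_mod_orderOf, hk.of_dvd (orderOf_dvd_of_pow_eq_one hχ), pow_mod_orderOf]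
    rw [← h2, gaussSum_pow_char_pow, hg]
    simp
  · rw [h1]
    have h2 : χ ^ p ^ k = (χ ^ j)⁻¹ := by
      rw [eq_inv_iff_mul_eq_one, ← pow_add]
      refine (orderOf_dvd_iff_pow_eq_one).1 ((orderOf_dvd_of_pow_eq_one hχ).trans ?_)
      rw [← ZMod.natCast_eq_zero_iff, Nat.cast_add, hk, neg_add_cancel]
    have hodd : Odd (p1 ^ m) := Odd.pow ⟨p1 / 2, by omega⟩
    have hneg : (χ ^ p ^ k) (-1) = 1 := by
      refine mulChar_neg_one_of_pow_odd_eq_one hodd ?_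
      rw [pow_right_comm, hχ, one_pow]
    rw [← inv_inv (χ ^ j), ← h2, gaussSum_inv_eq_star hneg, gaussSum_pow_char_pow, hg, star_add,
      hA, hB]
    simp

end GaussSums

section Spectrum

lemma eq_one_or_neg_one_of_sq_mul_eq {p p1 h : ℕ} (hp : p.Prime) (hp1 : Odd p1) {b : ℤ}
    (hb : ¬ (p : ℤ) ∣ b) (hbc : b ^ 2 + (p1 : ℤ) * b ^ 2 = 4 * (p : ℤ) ^ h) : b = 1 ∨ b = -1 := by
  have hpZ : Prime (p : ℤ) := Nat.prime_iff_prime_int.1 hp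
  have hcop : IsCoprime (b ^ 2) ((p : ℤ) ^ h) :=
    (((Prime.coprime_iff_not_dvd hpZ).2 hb).symm).pow
  have hdvd : b ^ 2 ∣ 4 := by
    refine hcop.dvd_of_dvd_mul_right ?_
    rw [← hbc]
    exact ⟨1 + p1, by ring⟩
  have hle : b ^ 2 ≤ 4 := Int.le_of_dvd (by norm_num) hdvd
  have h1 : b ≤ 2 := by nlinarith
  have h2 : -2 ≤ b := by nlinarith
  have hb2 : (b = 2 ∨ b = -2) → False := by
    intro hb'
    have hp2 : p ≠ 2 := by
      rintro rfl
      rcases hb' with rfl | rfl <;> norm_num at hb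
    have hsq : b ^ 2 = 4 := by rcases hb' with rfl | rfl <;> norm_num
    rw [hsq] at hbc
    have h3 : 1 + p1 = p ^ h := by
      have : (1 : ℤ) + p1 = (p : ℤ) ^ h := by linarith
      exact_mod_cast this
    have h4 : Odd (p ^ h) := (hp.odd_of_ne_two hp2).pow
    rw [← h3] at h4
    exact Nat.not_even_iff_odd.2 h4 (by simpa [add_comm] using hp1.add_one)
  have hb0 : b ≠ 0 := by
    rintro rfl
    simp at hb
  have : b = 1 ∨ b = -1 ∨ b = 2 ∨ b = -2 := by omega
  tauto

variable {F : Type} [Field F] [Fintype F] {γ : F} {χ : MulChar F ℂ} {ζ : ℂ} {D : Set F}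
  {p p1 m : ℕ} [Fact p.Prime] [Fact p1.Prime] [Algebra (ZMod p) F]

/-- The nontrivial eigenvalues of the Cayley graph are `α + A` and `α ± δ`, and all are attained. -/
lemma exists_eigenvalues (h3 : p1 % 4 = 3) (hm : 1 ≤ m) (hcop : Nat.Coprime p (p1 ^ m))
    (hf2 : 2 * orderOf (p : ZMod (p1 ^ m)) = (p1 ^ m).totient)
    (hγ0 : γ ≠ 0) (hγ : ∀ x : F, x ≠ 0 → ∃ k : ℕ, x = γ ^ k)
    (hζ : IsPrimitiveRoot ζ (p1 ^ m)) (hχ : χ γ = ζ)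
    (hD : D = {x : F | ∃ i < p1 ^ (m - 1), ∃ t : ℕ, x = γ ^ (i + p1 ^ m * t)})
    {A B δ : ℂ} (hA : star A = A) (hB : star B = -B) (hBδ : B ^ 2 = -(p1 * δ ^ 2))
    (hg : gaussSum χ⁻¹ (traceAddChar p F) = A + B) :
    ∃ α : ℂ,
      (∀ y, y ≠ 0 → cayleyEigenvalue (traceAddChar p F) D y = α + A ∨
        cayleyEigenvalue (traceAddChar p F) D y = α + δ ∨
        cayleyEigenvalue (traceAddChar p F) D y = α - δ) ∧
      (∃ y, y ≠ 0 ∧ cayleyEigenvalue (traceAddChar p F) D y = α + A) ∧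
      (∃ y, y ≠ 0 ∧ cayleyEigenvalue (traceAddChar p F) D y = α + δ) ∧
      (∃ y, y ≠ 0 ∧ cayleyEigenvalue (traceAddChar p F) D y = α - δ) := by
  have hp1 : p1.Prime := Fact.out
  have hp1C : (p1 : ℂ) ≠ 0 := Nat.cast_ne_zero.2 hp1.ne_zero
  obtain ⟨M, hMdef⟩ : ∃ M, M = p1 ^ (m - 1) := ⟨_, rfl⟩
  have hM : 0 < M := hMdef ▸ pow_pos hp1.pos _
  have hMC : (M : ℂ) ≠ 0 := Nat.cast_ne_zero.2 hM.ne'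
  have hNM : p1 ^ m = p1 * M := by rw [hMdef, ← pow_succ', Nat.sub_add_cancel hm]
  have hN : 0 < p1 ^ m := pow_pos hp1.pos _
  have hMN : M ≤ p1 ^ m := hNM ▸ Nat.le_mul_of_pos_left M hp1.pos
  have hω : IsPrimitiveRoot (ζ ^ M) p1 := hζ.pow hN (by rw [hNM, mul_comm])
  have hχN : χ ^ p1 ^ m = 1 := by
    ext u
    obtain ⟨k, hk⟩ := hγ u u.ne_zero
    rw [MulChar.pow_apply_coe, MulChar.one_apply_coe, hk, map_pow, hχ, pow_right_comm,
      hζ.pow_eq_one, one_pow]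
  have hG0 : gaussSum (χ⁻¹ ^ 0) (traceAddChar p F) = -1 := by
    rw [pow_zero, gaussSum_one_left traceAddChar_ne_one]
  set τ := gaussSum (complexQuadraticChar p1) (AddChar.zmodChar p1 hω.pow_eq_one) with hτdef
  have hτ : (B * τ) ^ 2 = (p1 * δ) ^ 2 := by
    rw [mul_pow, hBδ, hτdef, complexQuadraticChar_gaussSum_sq h3
      (AddChar.zmodChar_primitive_of_primitive_root p1 hω)]
    ring
  set α := (-1 - A) / (p1 : ℂ) with hα
  have hE : ∀ a i n : ℕ, i < M → a + i = M * n →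
      cayleyEigenvalue (traceAddChar p F) D (γ ^ a) =
        α + (if (n : ZMod p1) = 0 then A else 0) +
          B * τ / p1 * complexQuadraticChar p1 (n : ZMod p1) := by
    intro a i n hi hin
    have h1 := cayleyEigenvalue_mul_eq_sum_gaussSum hγ0 hγ hN hMN hζ hχ (hMdef ▸ hD)
      (traceAddChar p F) a
    have h2 := double_sum_eq h3 hM (hNM ▸ hζ) hω (G := fun j => gaussSum (χ⁻¹ ^ j)
      (traceAddChar p F)) hG0 (fun j hj => gaussSum_pow_eq h3 hm hcop hf2
        (by rw [inv_pow, hχN, inv_one]) hA hB hg hj) hi hin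
    rw [hNM, h2] at h1
    push_cast at h1
    rw [hα]
    field_simp
    refine mul_right_cancel₀ hMC ?_
    rw [mul_assoc, h1]
    split_ifs <;> ring
  have hγpow : ∀ a : ℕ, γ ^ a ≠ 0 := fun a => pow_ne_zero a hγ0
  have hE0 : ∃ y, y ≠ 0 ∧ cayleyEigenvalue (traceAddChar p F) D y = α + A := by
    refine ⟨γ ^ 0, hγpow 0, ?_⟩
    rw [hE 0 0 0 hM (by simp), Nat.cast_zero, MulChar.map_zero]
    simp
  have hE1 : ∃ y, y ≠ 0 ∧ cayleyEigenvalue (traceAddChar p F) D y = α + B * τ / p1 := by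
    refine ⟨γ ^ (M * 1), hγpow _, ?_⟩
    rw [hE (M * 1) 0 1 hM (by simp)]
    simp
  have hE2 : ∃ y, y ≠ 0 ∧ cayleyEigenvalue (traceAddChar p F) D y = α - B * τ / p1 := by
    refine ⟨γ ^ (M * (p1 - 1)), hγpow _, ?_⟩
    rw [hE (M * (p1 - 1)) 0 (p1 - 1) hM (by simp), Nat.cast_sub hp1.one_le]
    simp only [CharP.cast_eq_zero, Nat.cast_one, zero_sub, complexQuadraticChar_apply,
      quadraticChar_neg_one_of_mod_four h3]
    simp [sub_eq_add_neg]
  have hall : ∀ y, y ≠ 0 → cayleyEigenvalue (traceAddChar p F) D y = α + A ∨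
      cayleyEigenvalue (traceAddChar p F) D y = α + B * τ / p1 ∨
      cayleyEigenvalue (traceAddChar p F) D y = α - B * τ / p1 := by
    intro y hy
    obtain ⟨a, rfl⟩ := hγ y hy
    obtain ⟨i, hi, ⟨n, hin⟩, -⟩ := exists_unique_dvd_add M a hM
    rw [hE a i n hi hin]
    by_cases hn : (n : ZMod p1) = 0
    · left
      simp only [hn, MulChar.map_zero]
      simp
    · right
      rcases quadraticChar_dichotomy hn with h | h
      · left
        simp [hn, complexQuadraticChar_apply, h]
      · right
        simp [hn, complexQuadraticChar_apply, h, sub_eq_add_neg]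
  refine ⟨α, ?_⟩
  rcases sq_eq_sq_iff_eq_or_eq_neg.1 hτ with h | h
  · have h4 : B * τ / p1 = δ := by rw [h, mul_div_cancel_left₀ _ hp1C]
    rw [h4] at hE1 hE2
    simp only [h4] at hall
    exact ⟨hall, hE0, hE1, hE2⟩
  · have h4 : B * τ / p1 = -δ := by rw [h, neg_div, mul_div_cancel_left₀ _ hp1C]
    rw [h4, ← sub_eq_add_neg] at hE1
    rw [h4, sub_neg_eq_add] at hE2
    simp only [h4, ← sub_eq_add_neg, sub_neg_eq_add] at hall
    exact ⟨fun y hy => (hall y hy).imp_right Or.symm, hE0, hE2, hE1⟩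

end Spectrum

/-- Criterion for `Cay(F_q, D_0)` with `N = p1^m` to be strongly regular, in terms of the
index-2 Gauss sum data `(b, c)` (Corollary 4.2 in [FX]). -/
theorem cayley_srg_iff_prime_power
    (p1 m N p f q : ℕ)
    (hp1 : p1.Prime) (hp1_gt : 3 < p1) (hp1_mod : p1 % 4 = 3)
    (hm : 1 ≤ m) (hN : N = p1 ^ m)
    (hp : p.Prime) (hcop : Nat.Coprime p N)
    (hf : f = orderOf (p : ZMod N)) (hf2 : 2 * f = N.totient)
    (hq : q = p ^ f)
    (F : Type) [Field F] [Fintype F] [Algebra (ZMod p) F]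
    (hF : Fintype.card F = q)
    (γ : Fˣ) (hγ : orderOf γ = q - 1)
    (D0 : Set F)
    (hD0 : D0 = {x : F | ∃ i < p1 ^ (m - 1), ∃ t : ℕ, x = ((γ : F)) ^ (i + N * t)})
    (χ : MulChar F ℂ)
    (hχ : χ ((γ : F)) = Complex.exp (2 * (Real.pi : ℂ) * Complex.I / (N : ℂ)))
    (K : Type) [Field K] [NumberField K]
    (hK : Module.finrank ℚ K = 2) (hKα : ∃ α : K, α ^ 2 = -(p1 : K))
    (h h0 : ℕ) (hh : h = NumberField.classNumber K) (hh0 : h0 = (f - h) / 2)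
    (b c : ℤ) (hb : ¬ (p : ℤ) ∣ b) (hc : ¬ (p : ℤ) ∣ c)
    (hbc : b ^ 2 + (p1 : ℤ) * c ^ 2 = 4 * (p : ℤ) ^ h)
    (hbmod : b * (p : ℤ) ^ h0 ≡ -2 [ZMOD (p1 : ℤ)])
    (hg : (∑ a : F, (starRingEnd ℂ) (χ a) *
            Complex.exp (2 * (Real.pi : ℂ) * Complex.I *
              ((Algebra.trace (ZMod p) F a).val : ℂ) / (p : ℂ)))
        = (((b : ℂ) + (c : ℂ) * Complex.I * (Real.sqrt p1 : ℂ)) / 2) * (p : ℂ) ^ h0) :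
    (SimpleGraph.fromRel (fun x y : F => x - y ∈ D0) ≠ ⊤ ∧
     SimpleGraph.fromRel (fun x y : F => x - y ∈ D0) ≠ ⊥ ∧
     ∃ k l u : ℕ, (SimpleGraph.fromRel (fun x y : F => x - y ∈ D0)).IsSRGWith q k l u) ↔
    ((b = 1 ∨ b = -1) ∧ (c = 1 ∨ c = -1)) := by
  have : Fact p.Prime := ⟨hp⟩
  have : Fact p1.Prime := ⟨hp1⟩
  subst hN hf hq
  have hp1pos : 0 < p1 := hp1.pos
  have hodd : Odd (p1 ^ m) := Odd.pow ⟨p1 / 2, by omega⟩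
  have hγ0 : (γ : F) ≠ 0 := γ.ne_zero
  have hγgen : ∀ x : F, x ≠ 0 → ∃ k : ℕ, x = (γ : F) ^ k := by
    intro x hx
    have hcard : orderOf γ = Nat.card Fˣ := by
      rw [hγ, Nat.card_eq_fintype_card, Fintype.card_units, hF]
    have hmem : Units.mk0 x hx ∈ Submonoid.powers γ := by
      rw [mem_powers_iff_mem_zpowers,
        Subgroup.eq_top_of_card_eq _ ((Nat.card_zpowers γ).trans hcard)]
      trivial
    obtain ⟨k, hk⟩ := hmem
    refine ⟨k, ?_⟩
    have h1 := congrArg Units.val hk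
    simpa using h1.symm
  have hζ := Complex.isPrimitiveRoot_exp (p1 ^ m) (pow_pos hp1pos m).ne'
  rw [← hχ] at hζ
  set ψ := traceAddChar p F with hψ
  have hprim : ψ.IsPrimitive := AddChar.IsPrimitive.of_ne_one traceAddChar_ne_one
  have hP0 : (p : ℂ) ^ h0 ≠ 0 := pow_ne_zero _ (Nat.cast_ne_zero.2 hp.ne_zero)
  have hgauss : gaussSum χ⁻¹ ψ = (b : ℂ) / 2 * (p : ℂ) ^ h0 +
      (c : ℂ) * Complex.I * (Real.sqrt p1 : ℂ) / 2 * (p : ℂ) ^ h0 := by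
    rw [← add_mul, ← add_div, ← hg, gaussSum]
    refine Finset.sum_congr rfl fun a _ => ?_
    rw [hψ, traceAddChar_apply, ← MulChar.star_apply']
    rfl
  have hsqrt : (Real.sqrt p1 : ℂ) ^ 2 = p1 := by
    rw [← Complex.ofReal_pow, Real.sq_sqrt (Nat.cast_nonneg p1), Complex.ofReal_natCast]
  obtain ⟨α, hall, ⟨y0, hy0, hE0⟩, ⟨y1, hy1, hE1⟩, ⟨y2, hy2, hE2⟩⟩ :=
    exists_eigenvalues (δ := (c : ℂ) / 2 * (p : ℂ) ^ h0) hp1_mod hm hcop hf2 hγ0 hγgen hζ rfl hD0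
      (by simp) (by simp [neg_div]) (by
        rw [mul_pow, div_pow, mul_pow, mul_pow, Complex.I_sq, hsqrt]
        ring) hgauss
  have hone : (1 : F) ∈ D0 := by
    rw [hD0]
    exact ⟨0, pow_pos hp1pos _, 0, by simp⟩
  have hzero : (0 : F) ∉ D0 := by
    rw [hD0]
    rintro ⟨i, _, t, h⟩
    exact pow_ne_zero _ hγ0 h.symm
  have hneg : ∀ x ∈ D0, -x ∈ D0 := by
    obtain ⟨k, hk⟩ := hγgen (-1) (by simp)
    have hχN : χ ^ p1 ^ m = 1 := by
      ext u
      obtain ⟨j, hj⟩ := hγgen u u.ne_zero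
      rw [MulChar.pow_apply_coe, MulChar.one_apply_coe, hj, map_pow, pow_right_comm,
        hζ.pow_eq_one, one_pow]
    have h1 := mulChar_neg_one_of_pow_odd_eq_one hodd hχN
    rw [hk, map_pow, hζ.pow_eq_one_iff_dvd] at h1
    obtain ⟨k', rfl⟩ := h1
    rw [hD0]
    rintro x ⟨i, hi, t, rfl⟩
    refine ⟨i, hi, t + k', ?_⟩
    rw [neg_eq_neg_one_mul, hk, ← pow_add]
    ring_nf
  have hnotin : (γ : F) ^ p1 ^ (m - 1) ∉ D0 := by
    rw [hD0]
    rintro ⟨i, hi, t, h⟩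
    have h1 := congrArg χ h
    have hlt : p1 ^ (m - 1) < p1 ^ m := Nat.pow_lt_pow_right hp1.one_lt (by omega)
    rw [map_pow, map_pow, pow_add, pow_mul _ (p1 ^ m), hζ.pow_eq_one, one_pow, mul_one] at h1
    exact hi.ne' (hζ.pow_inj hlt (hi.trans hlt) h1)
  have hc0 : (c : ℂ) ≠ 0 := by
    rw [Int.cast_ne_zero]
    rintro rfl
    simp at hc
  constructor
  · rintro ⟨-, -, k, l, u, hG⟩
    obtain ⟨s, t, hst⟩ := exists_quadratic_of_isSRGWith hprim hzero hneg hG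
    have h0' := hst y0 hy0
    have h1' := hst y1 hy1
    have h2' := hst y2 hy2
    rw [hE0] at h0'
    rw [hE1] at h1'
    rw [hE2] at h2'
    have hs : 2 * α = s := by
      refine sub_eq_zero.1 ((mul_eq_zero.1 ?_).resolve_left (mul_ne_zero hc0 hP0))
      linear_combination h1' - h2'
    have hsq : (b : ℂ) ^ 2 = (c : ℂ) ^ 2 := by
      refine sub_eq_zero.1 ((mul_eq_zero.1 ?_).resolve_left (pow_ne_zero 2 hP0))
      rw [← hs] at h0' h1'
      linear_combination 4 * (h0' - h1')
    have hsqZ : b ^ 2 = c ^ 2 := by exact_mod_cast hsq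
    have hp1odd : Odd p1 := ⟨p1 / 2, by omega⟩
    exact ⟨eq_one_or_neg_one_of_sq_mul_eq hp hp1odd hb (by rw [hsqZ] at hbc ⊢; exact hbc),
      eq_one_or_neg_one_of_sq_mul_eq hp hp1odd hc (by rw [hsqZ] at hbc; exact hbc)⟩
  · rintro ⟨hb1, hc1⟩
    refine ⟨?_, ?_, ?_⟩
    · intro htop
      apply hnotin
      have h1 : (SimpleGraph.fromRel (fun x y : F => x - y ∈ D0)).Adj
          ((γ : F) ^ p1 ^ (m - 1)) 0 := by
        rw [htop, SimpleGraph.top_adj]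
        exact pow_ne_zero _ hγ0
      rwa [fromRel_sub_mem_adj hzero hneg, sub_zero] at h1
    · intro hbot
      have h1 : (SimpleGraph.fromRel (fun x y : F => x - y ∈ D0)).Adj 1 0 := by
        rwa [fromRel_sub_mem_adj hzero hneg, sub_zero]
      rw [hbot] at h1
      exact h1
    · have hsq : (b : ℂ) ^ 2 = (c : ℂ) ^ 2 := by
        rcases hb1 with rfl | rfl <;> rcases hc1 with rfl | rfl <;> norm_num
      rw [← hF]
      refine exists_isSRGWith_of_quadratic hprim hzero hneg (s := 2 * α)
        (t := ((c : ℂ) / 2 * (p : ℂ) ^ h0) ^ 2 - α ^ 2) fun y hy => ?_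
      rcases hall y hy with h1 | h1 | h1 <;> rw [h1]
      · linear_combination ((p : ℂ) ^ h0) ^ 2 / 4 * hsq
      · ring
      · ring
end
end

section
/- Let m ≥ 1, p = 2, p1 = 5, p2 = 3, N = 5^m·3, and q = 2^{4·5^{m−1}}. Then for every k with 0 ≤ k ≤ 14, the Cayley graph Cay(F_q, D_k) is a strongly regular graph of degree (q−1)/15, where D_k = ∪_{i=0}^{5^{m−1}−1} C_{3i + k·5^{m−1}}. -/
open scoped Classical

noncomputable section

/-- The number of ones among the first `f` binary digits of `a`. -/
def binaryWeight (f a : ℕ) : ℕ := ∑ i ∈ Finset.range f, a / 2 ^ i % 2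

lemma binaryWeight_succ (f a : ℕ) :
    binaryWeight (f + 1) a = binaryWeight f (a / 2) + a % 2 := by
  simp [binaryWeight, Finset.sum_range_succ', Nat.div_div_eq_div_mul, pow_succ']

lemma binaryWeight_add_sum_div (f a : ℕ) (ha : a < 2 ^ f) :
    binaryWeight f a + ∑ i ∈ Finset.range f, a / 2 ^ (i + 1) = a := by
  induction f generalizing a with
  | zero => simp_all [binaryWeight]
  | succ f ih =>
    have h := ih (a / 2) (by rw [pow_succ] at ha; omega)
    have h2 : ∑ i ∈ Finset.range (f + 1), a / 2 ^ (i + 1)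
        = ∑ i ∈ Finset.range f, a / 2 / 2 ^ (i + 1) + a / 2 := by
      simp [Finset.sum_range_succ', Nat.div_div_eq_div_mul, pow_succ']
    rw [binaryWeight_succ, h2]
    omega

/-- Doubling modulo `2 ^ f - 1` rotates the binary digits, so the weight is an average of residues. -/
lemma mul_binaryWeight (f a : ℕ) (ha : a < 2 ^ f - 1) :
    (2 ^ f - 1) * binaryWeight f a = ∑ i ∈ Finset.range f, 2 ^ i * a % (2 ^ f - 1) := by
  have hdiv : ∀ i ∈ Finset.range f, 2 ^ i * a / (2 ^ f - 1) = a / 2 ^ (f - i) := by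
    intro i hi
    have hi := Finset.mem_range.mp hi
    obtain ⟨j, rfl⟩ := Nat.exists_eq_add_of_lt hi
    have e : i + j + 1 - i = j + 1 := by omega
    rw [e]
    have hr := Nat.mod_lt a (show 0 < 2 ^ (j + 1) by positivity)
    have hd := Nat.div_add_mod a (2 ^ (j + 1))
    have hp : (2 : ℕ) ^ (i + j + 1) = 2 ^ i * 2 ^ (j + 1) := by ring
    have h1 : 0 < 2 ^ i := by positivity
    set x := a / 2 ^ (j + 1)
    set y := a % 2 ^ (j + 1)
    set P := 2 ^ i
    set Q := 2 ^ (j + 1)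
    rw [hp] at ha ⊢
    have hpos : 0 < P * Q := by positivity
    have hx : x < P := by
      by_contra hc
      have : Q * P ≤ Q * x := Nat.mul_le_mul_left _ (by omega)
      have : P * Q = Q * P := mul_comm _ _
      omega
    obtain ⟨M, hM⟩ : ∃ M, P * Q = M + 1 := ⟨P * Q - 1, by omega⟩
    rw [hM] at ha ⊢
    simp only [Nat.add_sub_cancel] at ha ⊢
    have key : P * a = M * x + (P * y + x) := by
      rw [← hd]
      nlinarith
    have hlt : P * y + x < M := by
      by_contra hc
      have hy : P * (y + 1) ≤ P * Q := Nat.mul_le_mul_left _ hr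
      have hyQ : y + 1 = Q := by
        by_contra hne
        have : P * (y + 2) ≤ P * Q := Nat.mul_le_mul_left _ (by omega)
        nlinarith
      have hxP : x + 1 = P := by nlinarith
      have : Q * x + y + 1 = P * Q := by rw [← hyQ, ← hxP]; ring
      omega
    rw [key, Nat.mul_add_div (by omega), Nat.div_eq_of_lt hlt, add_zero]
  have h1 : ∑ i ∈ Finset.range f, 2 ^ i * a / (2 ^ f - 1)
      = ∑ i ∈ Finset.range f, a / 2 ^ (i + 1) := by
    rw [Finset.sum_congr rfl hdiv, ← Finset.sum_range_reflect (fun i => a / 2 ^ (i + 1))]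
    refine Finset.sum_congr rfl fun i hi => ?_
    have hi := Finset.mem_range.mp hi
    congr 2
    omega
  have h2 : ∑ i ∈ Finset.range f, 2 ^ i * a = (2 ^ f - 1) * a := by
    rw [← Finset.sum_mul, Nat.geomSum_eq le_rfl]
    simp
  have h3 : ∑ i ∈ Finset.range f, 2 ^ i * a % (2 ^ f - 1)
      + (2 ^ f - 1) * ∑ i ∈ Finset.range f, 2 ^ i * a / (2 ^ f - 1) = (2 ^ f - 1) * a := by
    rw [Finset.mul_sum, ← Finset.sum_add_distrib, ← h2]
    exact Finset.sum_congr rfl fun i _ => Nat.mod_add_div _ _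
  have h4 := binaryWeight_add_sum_div f a (by omega)
  rw [h1] at h3
  have h5 := congrArg ((2 ^ f - 1) * ·) h4
  simp only [mul_add] at h5
  omega

lemma exists_sixteen_pow (k : ℕ) :
    ∃ u, 16 ^ 5 ^ k = 1 + 15 * 5 ^ k * (1 + 5 * u) := by
  induction k with
  | zero => exact ⟨0, by norm_num⟩
  | succ k ih =>
    obtain ⟨u, hu⟩ := ih
    rw [pow_succ 5 k, pow_mul, hu]
    set x := 3 * 5 ^ k * (1 + 5 * u) with hx
    have : 15 * 5 ^ k * (1 + 5 * u) = 5 * x := by rw [hx]; ring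
    refine ⟨u + (1 + 5 * u) * (2 * x + 10 * x ^ 2 + 25 * x ^ 3 + 25 * x ^ 4), ?_⟩
    rw [this]
    have h2 : 15 * (5 ^ k * 5) * (1 + 5 * (u + (1 + 5 * u) * (2 * x + 10 * x ^ 2 + 25 * x ^ 3
        + 25 * x ^ 4))) = 25 * x * (1 + 5 * (2 * x + 10 * x ^ 2 + 25 * x ^ 3 + 25 * x ^ 4)) := by
      rw [hx]; ring
    rw [h2]; ring

lemma sum_affine_mod_five (h w : ℕ) (hw : ¬ 5 ∣ w) :
    ∑ j ∈ Finset.range 5, (h + w * j) % 5 = 10 := by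
  have hw' : w % 5 ≠ 0 := fun h => hw (Nat.dvd_of_mod_eq_zero h)
  have e : ∀ j, (h + w * j) % 5 = (h % 5 + w % 5 * j) % 5 := fun j => by
    simp [Nat.add_mod, Nat.mul_mod]
  simp only [e]
  have h1 := Nat.mod_lt h (show 0 < 5 by norm_num)
  have h2 := Nat.mod_lt w (show 0 < 5 by norm_num)
  generalize h % 5 = r at *
  generalize w % 5 = s at *
  interval_cases r <;> interval_cases s <;> first | rfl | exact absurd rfl hw'

/-- The residues of `y * (1 + 3 n) ^ j` modulo `15 n` run over the lifts of `y` modulo `3 n`. -/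
lemma sum_residues_sixteen_pow (k y : ℕ) (hy : ¬ 5 ∣ y) :
    ∑ j ∈ Finset.range 5, 2 ^ (4 * 5 ^ k * j) * y % (15 * 5 ^ (k + 1))
      = 5 * (y % (15 * 5 ^ k)) + 30 * 5 ^ (k + 1) := by
  obtain ⟨u, hu⟩ := exists_sixteen_pow k
  set M := 15 * 5 ^ k with hM
  have hMpos : 0 < M := by positivity
  have hM5 : 15 * 5 ^ (k + 1) = M * 5 := by rw [hM]; ring
  have hterm : ∀ j, 2 ^ (4 * 5 ^ k * j) * y % (M * 5)
      = y % M + M * ((y / M + y * (1 + 5 * u) * j) % 5) := by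
    intro j
    have h1 : 2 ^ (4 * 5 ^ k * j) ≡ 1 + M * (1 + 5 * u) * j [MOD M * 5] := by
      have : (2 : ℕ) ^ (4 * 5 ^ k * j) = (1 + M * (1 + 5 * u)) ^ j := by
        rw [pow_mul, pow_mul, ← hu]; norm_num
      rw [this]
      induction j with
      | zero => simp [Nat.ModEq]
      | succ j ih =>
        rw [pow_succ]
        have h5 : M * M = M * 5 * (3 * 5 ^ k) := by rw [hM]; ring
        have e : (1 + M * (1 + 5 * u) * j) * (1 + M * (1 + 5 * u))
            = (1 + M * (1 + 5 * u) * (j + 1)) + M * 5 * ((3 * 5 ^ k) * (1 + 5 * u) ^ 2 * j) := by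
          have : (1 + M * (1 + 5 * u) * j) * (1 + M * (1 + 5 * u))
            = (1 + M * (1 + 5 * u) * (j + 1)) + M * M * (1 + 5 * u) ^ 2 * j := by ring
          rw [this, h5]; ring
        refine (ih (by
          rw [pow_mul, pow_mul, ← hu]; norm_num)).mul_right _ |>.trans ?_
        rw [e]
        simp [Nat.ModEq]
    have h2 : 2 ^ (4 * 5 ^ k * j) * y ≡ y % M + M * (y / M + y * (1 + 5 * u) * j) [MOD M * 5] := by
      refine (h1.mul_right y).trans ?_
      have : (1 + M * (1 + 5 * u) * j) * y = y % M + M * (y / M + y * (1 + 5 * u) * j) := by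
        have := Nat.mod_add_div y M
        linear_combination this.symm
      rw [this]
    rw [h2, Nat.mod_mul, Nat.add_mul_mod_self_left, Nat.mod_mod, Nat.add_mul_div_left _ _ hMpos,
      Nat.div_eq_of_lt (Nat.mod_lt y hMpos), zero_add]
  have hw : ¬ 5 ∣ y * (1 + 5 * u) := by
    rw [Nat.Prime.dvd_mul (by norm_num)]
    omega
  rw [hM5, Finset.sum_congr rfl (fun j _ => hterm j), Finset.sum_add_distrib, ← Finset.mul_sum,
    sum_affine_mod_five _ _ hw]
  simp only [Finset.sum_const, Finset.card_range, smul_eq_mul]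
  rw [hM]; ring

lemma sum_range_mul_add (f : ℕ → ℕ) (a b : ℕ) :
    ∑ i ∈ Finset.range (a * b), f i
      = ∑ i ∈ Finset.range a, ∑ j ∈ Finset.range b, f (a * j + i) := by
  rw [Finset.sum_comm]
  induction b with
  | zero => simp
  | succ b ih => rw [Nat.mul_succ, Finset.sum_range_add, ih, Finset.sum_range_succ]

/-- Residue form of the bound for classes prime to five. -/
lemma sum_residues_le (k c : ℕ) (hc : ¬ 5 ∣ c) :
    ∑ i ∈ Finset.range (4 * 5 ^ k), 2 ^ i * c % (15 * 5 ^ k)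
      ≤ 15 * 5 ^ k * (2 * 5 ^ k + 1) := by
  induction k with
  | zero =>
    have hlt := Nat.mod_lt c (show 0 < 15 by norm_num)
    have h : ∀ i, 2 ^ i * c % 15 = 2 ^ i * (c % 15) % 15 := fun i => by simp [Nat.mul_mod]
    have hc' : ¬ 5 ∣ c % 15 := by omega
    simp only [pow_zero, mul_one, h]
    generalize c % 15 = r at hlt hc'
    revert hc'
    revert r
    decide
  | succ k ih =>
    have e : 4 * 5 ^ (k + 1) = 4 * 5 ^ k * 5 := by ring
    rw [e, sum_range_mul_add]
    have h : ∀ i ∈ Finset.range (4 * 5 ^ k),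
        ∑ j ∈ Finset.range 5, 2 ^ (4 * 5 ^ k * j + i) * c % (15 * 5 ^ (k + 1))
          = 5 * (2 ^ i * c % (15 * 5 ^ k)) + 30 * 5 ^ (k + 1) := by
      intro i _
      have hd : ¬ 5 ∣ 2 ^ i * c := by
        rw [Nat.Prime.dvd_mul (by norm_num)]
        rintro (h | h)
        · have := Nat.Prime.dvd_of_dvd_pow (by norm_num) h
          omega
        · exact hc h
      rw [← sum_residues_sixteen_pow k _ hd]
      exact Finset.sum_congr rfl fun j _ => by rw [pow_add, mul_assoc]
    rw [Finset.sum_congr rfl h, Finset.sum_add_distrib, ← Finset.mul_sum]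
    simp only [Finset.sum_const, Finset.card_range, smul_eq_mul]
    rw [pow_succ]
    nlinarith

/-- Residue form of the bound for classes of order three. -/
lemma sum_residues_mod_three_le (n c : ℕ) :
    ∑ i ∈ Finset.range (4 * n), 2 ^ i * c % 3 ≤ 3 * (2 * n) := by
  have h4 : ∀ i, 2 ^ (4 * i) * c % 3 = c % 3 := fun i => by
    rw [pow_mul, Nat.mul_mod, Nat.pow_mod]; simp
  induction n with
  | zero => simp
  | succ n ih =>
    rw [Nat.mul_succ, Finset.sum_range_add]
    simp only [Finset.sum_range_succ, Finset.sum_range_zero, pow_add, mul_assoc]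
    have h := h4 n
    have e : ∀ x, 2 ^ (4 * n) * (x * c) = x * (2 ^ (4 * n) * c) := fun x => by ring
    simp only [e]
    omega

lemma binaryWeight_le (k a c M : ℕ) (hM : 2 ^ (4 * 5 ^ k) - 1 = 15 * 5 ^ k * M)
    (ha : a = c * M) (hlt : a < 2 ^ (4 * 5 ^ k) - 1) (hc : ¬ 5 ∣ c ∨ 5 ^ (k + 1) ∣ c) :
    binaryWeight (4 * 5 ^ k) a ≤ 2 * 5 ^ k + 1 := by
  have h := mul_binaryWeight _ _ hlt
  have hMpos : 0 < M := by
    rcases Nat.eq_zero_or_pos M with h0 | h0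
    · rw [hM, h0] at hlt; simp at hlt
    · exact h0
  have h2 : ∑ i ∈ Finset.range (4 * 5 ^ k), 2 ^ i * a % (2 ^ (4 * 5 ^ k) - 1)
      = (∑ i ∈ Finset.range (4 * 5 ^ k), 2 ^ i * c % (15 * 5 ^ k)) * M := by
    rw [Finset.sum_mul, hM]
    refine Finset.sum_congr rfl fun i _ => ?_
    rw [ha, ← mul_assoc, Nat.mul_mod_mul_right]
  have hle : ∑ i ∈ Finset.range (4 * 5 ^ k), 2 ^ i * c % (15 * 5 ^ k)
      ≤ 15 * 5 ^ k * (2 * 5 ^ k + 1) := by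
    rcases hc with hc | ⟨c', rfl⟩
    · exact sum_residues_le k c hc
    · have e : ∀ i ∈ Finset.range (4 * 5 ^ k), 2 ^ i * (5 ^ (k + 1) * c') % (15 * 5 ^ k)
          = 5 ^ (k + 1) * (2 ^ i * c' % 3) := fun i _ => by
        rw [← Nat.mul_mod_mul_left]
        congr 1 <;> ring
      rw [Finset.sum_congr rfl e, ← Finset.mul_sum]
      have := Nat.mul_le_mul_left (5 ^ (k + 1)) (sum_residues_mod_three_le (5 ^ k) c')
      refine this.trans ?_
      rw [pow_succ]
      nlinarith [Nat.zero_le (5 ^ k)]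
  rw [h2, hM] at h
  have h3 : 15 * 5 ^ k * M * binaryWeight (4 * 5 ^ k) a
      ≤ 15 * 5 ^ k * M * (2 * 5 ^ k + 1) := by
    rw [h]
    calc _ ≤ 15 * 5 ^ k * (2 * 5 ^ k + 1) * M := Nat.mul_le_mul_right _ hle
      _ = _ := by ring
  exact Nat.le_of_mul_le_mul_left h3 (by positivity)

section Stickelberger

lemma geom_sum_eq_zero_of_pow_eq_one {R : Type*} [CommRing R] [IsDomain R] {x : R} {k : ℕ} (hk : x ^ k = 1) (hx : x ≠ 1) :
    ∑ i ∈ Finset.range k, x ^ i = 0 := by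
  have h := geom_sum_mul x k
  rw [hk, sub_self] at h
  exact (mul_eq_zero.mp h).resolve_right (sub_ne_zero.mpr hx)

lemma gaussSum_sq_of_frobenius {F : Type*} [Field F] [Fintype F] [CharP F 2]
    {R : Type*} [CommRing R] (χ : MulChar F R) (ψ : AddChar F R)
    (hψ : ∀ x, ψ (x ^ 2) = ψ x) : gaussSum (χ ^ 2) ψ = gaussSum χ ψ := by
  unfold gaussSum
  refine Fintype.sum_bijective (fun x => x ^ 2) (frobeniusEquiv F 2).bijective _ _ fun x => ?_
  rw [hψ, map_pow, MulChar.pow_apply' _ two_ne_zero]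

variable {F : Type*} [Field F] [Fintype F] {R : Type*} [CommRing R] [IsDomain R]

/-- The easy half of Stickelberger's congruence in characteristic two. -/
lemma gaussSum_pow_dvd_two_pow [CharP F 2] (χ : MulChar F R) (ψ : AddChar F R)
    (hψ : ∀ x, ψ (x ^ 2) = ψ x) (hψ1 : ψ ≠ 1) (hχ : gaussSum χ ψ ∣ 2) (f a : ℕ)
    (ha : a < 2 ^ f) (h1 : ∀ j, 0 < j → j ≤ a → χ ^ j ≠ 1) :
    gaussSum (χ ^ a) ψ ∣ 2 ^ binaryWeight f a := by
  induction f generalizing a with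
  | zero =>
    obtain rfl : a = 0 := by simpa using ha
    rw [pow_zero, gaussSum_one_left hψ1]
    exact (isUnit_one.neg).dvd
  | succ f ih =>
    have h := ih (a / 2) (by rw [pow_succ] at ha; omega)
      (fun j hj hja => h1 j hj (by omega))
    rw [← gaussSum_sq_of_frobenius _ _ hψ, ← pow_mul] at h
    rw [binaryWeight_succ, pow_add]
    rcases Nat.mod_two_eq_zero_or_one a with h0 | h0
    · rw [h0, pow_zero, mul_one]
      rwa [show a / 2 * 2 = a by omega] at h
    · have e : χ ^ (a / 2 * 2) * χ = χ ^ a := by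
        rw [← pow_succ, show a / 2 * 2 + 1 = a by omega]
      rw [h0, pow_one]
      refine dvd_trans ?_ (mul_dvd_mul h hχ)
      rw [← jacobiSum_mul_nontrivial (by rw [e]; exact h1 a (by omega) le_rfl), e]
      exact dvd_mul_right _ _

/-- Stickelberger's lower bound for the `2`-divisibility of a Gauss sum. -/
lemma two_pow_dvd_gaussSum [CharP F 2] (χ : MulChar F R) (ψ : AddChar F R)
    (hψ : ∀ x, ψ (x ^ 2) = ψ x) (hψ1 : ψ ≠ 1) (hχ : gaussSum χ ψ ∣ 2) (h2 : (2 : R) ≠ 0)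
    (f a s : ℕ) (hF : Fintype.card F = 2 ^ f) (ha : a < 2 ^ f) (ha0 : 0 < a)
    (h1 : ∀ j, 0 < j → j ≤ a → χ ^ j ≠ 1) (hs : binaryWeight f a + s ≤ f) :
    2 ^ s ∣ gaussSum (χ ^ a)⁻¹ ψ := by
  obtain ⟨u, hu⟩ := gaussSum_pow_dvd_two_pow χ ψ hψ hψ1 hχ f a ha h1
  have hinv : ψ⁻¹ = ψ := by
    ext x
    rw [AddChar.inv_apply, CharTwo.neg_eq]
  have hg := gaussSum_mul_gaussSum_eq_card (h1 a ha0 le_rfl) (AddChar.IsPrimitive.of_ne_one hψ1)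
  rw [hinv, hF] at hg
  push_cast at hg
  have key : 2 ^ binaryWeight f a * gaussSum (χ ^ a)⁻¹ ψ
      = 2 ^ binaryWeight f a * (2 ^ s * (2 ^ (f - binaryWeight f a - s) * u)) := by
    have e : (2 : R) ^ f
        = 2 ^ binaryWeight f a * 2 ^ s * 2 ^ (f - binaryWeight f a - s) := by
      rw [← pow_add, ← pow_add]
      congr 1
      omega
    calc _ = (gaussSum (χ ^ a) ψ * gaussSum (χ ^ a)⁻¹ ψ) * u := by rw [hu]; ring
      _ = _ := by rw [hg, e]; ring
  exact ⟨_, mul_left_cancel₀ (pow_ne_zero _ h2) key⟩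

lemma sum_gaussSum_pow_mulShift (τ : MulChar F R) (hτ : ∀ x, τ x = 1 → x = 1)
    (ψ : AddChar F R) (a : F) :
    ∑ A ∈ Finset.range (Fintype.card F - 1), gaussSum (τ ^ A) (ψ.mulShift a)
      = ((Fintype.card F - 1 : ℕ) : R) * ψ a := by
  simp only [gaussSum]
  rw [Finset.sum_comm]
  simp only [← Finset.sum_mul]
  rw [Finset.sum_eq_single 1]
  · simp
  · intro x _ hx
    rcases eq_or_ne x 0 with rfl | h0
    · rw [Finset.sum_eq_zero fun A _ => MulChar.map_zero (τ ^ A), zero_mul]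
    · have e : ∀ A, (τ ^ A) x = τ x ^ A := fun A => MulChar.pow_apply_coe τ A (Units.mk0 x h0)
      simp only [e]
      rw [geom_sum_eq_zero_of_pow_eq_one _ (fun h => hx (hτ x h)), zero_mul]
      rw [← map_pow, FiniteField.pow_card_sub_one_eq_one x h0, map_one]
  · simp

/-- Fourier expansion of an additive character sum over a set of nonzero elements. -/
lemma card_sub_one_mul_sum_eq {ι : Type*} (τ : MulChar F R) (hτ : ∀ x, τ x = 1 → x = 1)
    (ψ : AddChar F R) (hψ : ψ ≠ 1) (S : Finset ι) (y : ι → Fˣ) (b : Fˣ) :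
    ((Fintype.card F - 1 : ℕ) : R) * ∑ j ∈ S, ψ (b * y j) + S.card
      = ∑ A ∈ Finset.Ico 1 (Fintype.card F - 1),
          (τ ^ A)⁻¹ b * ((∑ j ∈ S, (τ ^ A)⁻¹ (y j)) * gaussSum (τ ^ A) ψ) := by
  have hcard : 0 < Fintype.card F - 1 := by
    have := Fintype.one_lt_card (α := F)
    omega
  have h : ∀ a : Fˣ, ((Fintype.card F - 1 : ℕ) : R) * ψ a + 1
      = ∑ A ∈ Finset.Ico 1 (Fintype.card F - 1), (τ ^ A)⁻¹ a * gaussSum (τ ^ A) ψ := by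
    intro a
    rw [← sum_gaussSum_pow_mulShift τ hτ, Finset.range_eq_Ico,
      Finset.sum_eq_sum_Ico_succ_bot hcard]
    simp only [gaussSum_mulShift_eq]
    rw [pow_zero, gaussSum_one_left hψ]
    simp
  calc _ = ∑ j ∈ S, (((Fintype.card F - 1 : ℕ) : R) * ψ ((b * y j : Fˣ) : F) + 1) := by
        rw [Finset.sum_add_distrib, ← Finset.mul_sum]
        simp
    _ = _ := by
        simp only [h]
        rw [Finset.sum_comm]
        refine Finset.sum_congr rfl fun A _ => ?_
        rw [Finset.sum_mul, Finset.mul_sum]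
        refine Finset.sum_congr rfl fun j _ => ?_
        rw [Units.val_mul, map_mul, mul_assoc]

end Stickelberger

section Teichmuller

/-- The Teichmüller character with values in the Witt vectors. -/
def teichmullerChar (F : Type*) [Field F] : MulChar F (WittVector 2 F) where
  toMonoidHom := WittVector.teichmuller 2
  map_nonunit' a ha := by
    obtain rfl : a = 0 := by simpa using ha
    exact WittVector.teichmuller_zero 2

variable {F : Type*} [Field F]

lemma constantCoeff_teichmullerChar (x : F) :
    WittVector.constantCoeff (teichmullerChar F x) = x :=
  WittVector.teichmuller_coeff_zero 2 x

lemma teichmullerChar_eq_one {x : F} (h : teichmullerChar F x = 1) : x = 1 := by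
  rw [← constantCoeff_teichmullerChar x, h, map_one]

variable [CharP F 2]

lemma wittVector_two_ne_zero : (2 : WittVector 2 F) ≠ 0 := by
  exact_mod_cast (WittVector.irreducible 2 (k := F)).ne_zero

lemma wittVector_two_not_dvd_one : ¬ (2 : WittVector 2 F) ∣ 1 := by
  have h := (WittVector.irreducible 2 (k := F)).not_isUnit
  rw [isUnit_iff_dvd_one] at h
  exact_mod_cast h

lemma two_pow_dvd_of_wittVector (k : ℕ) (z : ℤ) (h : (2 : WittVector 2 F) ^ k ∣ (z : WittVector 2 F)) :
    (2 : ℤ) ^ k ∣ z := by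
  induction k generalizing z with
  | zero => simp
  | succ k ih =>
    have h2 : (2 : WittVector 2 F) ∣ z := (dvd_pow_self 2 (Nat.succ_ne_zero k)).trans h
    rcases Int.even_or_odd' z with ⟨w, rfl | rfl⟩
    · push_cast at h
      rw [pow_succ'] at h ⊢
      exact mul_dvd_mul_left _ (ih w ((mul_dvd_mul_iff_left wittVector_two_ne_zero).mp h))
    · push_cast at h2
      exact absurd ((dvd_add_right (dvd_mul_right _ _)).mp h2) wittVector_two_not_dvd_one

end Teichmuller

section SignCharacter

/-- The absolute trace of the field with `2 ^ f` elements, as a polynomial map. -/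
def absTrace {F : Type*} [Field F] (f : ℕ) (x : F) : F := ∑ i ∈ Finset.range f, x ^ 2 ^ i

lemma absTrace_add {F : Type*} [Field F] [CharP F 2] (f : ℕ) (x y : F) : absTrace f (x + y) = absTrace f x + absTrace f y := by
  simp [absTrace, ← Finset.sum_add_distrib, add_pow_char_pow]

variable {F : Type*} [Field F] [Fintype F] {f : ℕ}

lemma absTrace_sq (hF : Fintype.card F = 2 ^ f) (x : F) : absTrace f (x ^ 2) = absTrace f x := by
  have h := Finset.sum_range_succ (fun i => x ^ 2 ^ i) f
  rw [Finset.sum_range_succ', ← hF, FiniteField.pow_card] at h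
  simp only [pow_zero, pow_one, add_left_inj] at h
  simpa only [absTrace, ← pow_mul, ← pow_succ'] using h

lemma sum_inv_mul_absTrace (hF : Fintype.card F = 2 ^ f) (hf : 0 < f) : ∑ x : F, x⁻¹ * absTrace f x = -1 := by
  simp only [absTrace, Finset.mul_sum]
  rw [Finset.sum_comm]
  have hinner : ∀ i, ∑ x : F, x⁻¹ * x ^ 2 ^ i
      = if Fintype.card F - 1 ∣ 2 ^ i - 1 then -1 else 0 := by
    intro i
    rw [← FiniteField.sum_pow_units F, ← Finset.sum_subset (Finset.subset_univ
      (Finset.univ.filter fun x : F => x ≠ 0))]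
    · symm
      refine Finset.sum_bij (fun (u : Fˣ) _ => (u : F)) ?_ ?_ ?_ ?_
      · simp
      · exact fun a _ b _ h => Units.ext h
      · intro b hb
        exact ⟨Units.mk0 b (by simpa using hb), Finset.mem_univ _, rfl⟩
      · intro u _
        have : (2 : ℕ) ^ i = (2 ^ i - 1) + 1 := (Nat.sub_add_cancel Nat.one_le_two_pow).symm
        conv_rhs => rw [this, pow_succ']
        rw [inv_mul_cancel_left₀ u.ne_zero]
    · intro x _ hx
      obtain rfl : x = 0 := by simpa using hx
      simp
  simp only [hinner]
  rw [Finset.sum_eq_single 0]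
  · simp
  · intro i hi h0
    have hi := Finset.mem_range.mp hi
    rw [if_neg]
    intro hdvd
    have h1 : 2 ^ i < 2 ^ f := Nat.pow_lt_pow_right (by norm_num) hi
    have h2 : 1 < 2 ^ i := Nat.one_lt_two_pow h0
    have := Nat.le_of_dvd (by omega) hdvd
    omega
  · simp [hf.ne']

variable [CharP F 2]

lemma absTrace_eq_zero_or_one (hF : Fintype.card F = 2 ^ f) (x : F) : absTrace f x = 0 ∨ absTrace f x = 1 := by
  have h : absTrace f x ^ 2 = absTrace f x := by
    conv_rhs => rw [← absTrace_sq hF x]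
    simp only [absTrace]
    rw [sum_pow_char]
    exact Finset.sum_congr rfl fun i _ => by rw [← pow_mul, ← pow_mul, mul_comm]
  have h' : absTrace f x * (absTrace f x - 1) = 0 := by linear_combination h
  rcases mul_eq_zero.mp h' with h | h
  · exact Or.inl h
  · exact Or.inr (sub_eq_zero.mp h)

/-- The canonical additive character, with values `1` and `-1`. -/
def signChar (hF : Fintype.card F = 2 ^ f) : AddChar F ℤ where
  toFun x := if absTrace f x = 0 then 1 else -1
  map_zero_eq_one' := by simp [absTrace]
  map_add_eq_mul' x y := by
    rw [absTrace_add]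
    rcases absTrace_eq_zero_or_one hF x with h | h <;>
      rcases absTrace_eq_zero_or_one hF y with h' | h' <;>
      simp [h, h', CharTwo.add_self_eq_zero]

lemma signChar_sq (hF : Fintype.card F = 2 ^ f) (x : F) : signChar hF (x ^ 2) = signChar hF x := by
  change (if _ then _ else _ : ℤ) = if _ then _ else _
  rw [absTrace_sq hF]

lemma signChar_ne_one (hF : Fintype.card F = 2 ^ f) (hf : 0 < f) : signChar hF ≠ 1 := by
  intro h
  have h0 : ∀ x, absTrace f x = (0 : F) := by
    intro x
    have hx : (if absTrace f x = 0 then 1 else -1 : ℤ) = 1 := DFunLike.congr_fun h x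
    by_contra hne
    simp [hne] at hx
  have := sum_inv_mul_absTrace hF hf
  simp [h0] at this

lemma intCast_signChar (hF : Fintype.card F = 2 ^ f) (x : F) :
    ((signChar hF x : ℤ) : WittVector 2 F) = 1 - 2 * teichmullerChar F (absTrace f x) := by
  change (((if absTrace f x = 0 then 1 else -1 : ℤ)) : WittVector 2 F) = _
  rcases absTrace_eq_zero_or_one hF x with h | h
  · simp [h, MulChar.map_zero]
  · simp only [h, one_ne_zero, if_false, map_one]
    push_cast
    ring

/-- The canonical additive character with values in the Witt vectors. -/
def wittSignChar (hF : Fintype.card F = 2 ^ f) : AddChar F (WittVector 2 F) :=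
  (Int.castRingHom (WittVector 2 F)).toMonoidHom.compAddChar (signChar hF)

lemma wittSignChar_apply (hF : Fintype.card F = 2 ^ f) (x : F) :
    wittSignChar hF x = ((signChar hF x : ℤ) : WittVector 2 F) := rfl

lemma wittSignChar_ne_one (hF : Fintype.card F = 2 ^ f) (hf : 0 < f) : wittSignChar hF ≠ 1 := by
  intro h
  refine signChar_ne_one hF hf (DFunLike.ext _ _ fun x => ?_)
  have hx : ((signChar hF x : ℤ) : WittVector 2 F) = 1 := DFunLike.congr_fun h x
  change (if _ then _ else _ : ℤ) = 1
  rw [intCast_signChar] at hx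
  have h2 := (mul_eq_zero.mp (sub_eq_self.mp hx)).resolve_left wittVector_two_ne_zero
  rw [if_pos]
  rw [← constantCoeff_teichmullerChar (absTrace f x), h2, map_zero]

lemma gaussSum_teichmullerChar_inv_dvd_two (hF : Fintype.card F = 2 ^ f) (hf : 0 < f) (hne : (teichmullerChar F)⁻¹ ≠ 1) :
    gaussSum (teichmullerChar F)⁻¹ (wittSignChar hF) ∣ 2 := by
  have h : gaussSum (teichmullerChar F)⁻¹ (wittSignChar hF)
      = -(2 * ∑ x : F, (teichmullerChar F)⁻¹ x * teichmullerChar F (absTrace f x)) := by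
    simp only [gaussSum, wittSignChar_apply, intCast_signChar, mul_sub, mul_one,
      Finset.sum_sub_distrib]
    rw [MulChar.sum_eq_zero_of_ne_one hne, zero_sub, Finset.mul_sum]
    congr 1
    exact Finset.sum_congr rfl fun x _ => by ring
  have hu : IsUnit (∑ x : F, (teichmullerChar F)⁻¹ x * teichmullerChar F (absTrace f x)) := by
    apply WittVector.isUnit_of_coeff_zero_ne_zero
    change WittVector.constantCoeff _ ≠ 0
    simp only [map_sum, map_mul, MulChar.inv_apply', constantCoeff_teichmullerChar]
    rw [sum_inv_mul_absTrace hF hf]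
    exact neg_ne_zero.mpr one_ne_zero
  rw [h, neg_dvd, hu.mul_right_dvd]

end SignCharacter

section TwoValued

/-- The value at `b` of the Fourier transform of the indicator function of `D`. -/
def charSum {F : Type*} [Field F] (ψ : AddChar F ℤ) (D : Finset F) (b : F) : ℤ := ∑ x ∈ D, ψ (b * x)

lemma charSum_zero {F : Type*} [Field F] (ψ : AddChar F ℤ) (D : Finset F) : charSum ψ D 0 = D.card := by
  simp [charSum]

variable {F : Type*} [Field F] [Fintype F] [CharP F 2] {ψ : AddChar F ℤ}

lemma sum_charSum_mul (hψ : ψ ≠ 1) (D : Finset F) (z : F) :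
    ∑ b, charSum ψ D b * ψ (b * z) = if z ∈ D then (Fintype.card F : ℤ) else 0 := by
  simp only [charSum, Finset.sum_mul, ← AddChar.map_add_eq_mul, ← mul_add]
  rw [Finset.sum_comm]
  simp only [AddChar.sum_mulShift _ (AddChar.IsPrimitive.of_ne_one hψ),
    CharTwo.add_eq_zero, Nat.cast_ite, Nat.cast_zero, Finset.sum_ite_eq']

lemma sum_charSum_sq_mul (hψ : ψ ≠ 1) (D : Finset F) (z : F) :
    ∑ b, charSum ψ D b ^ 2 * ψ (b * z)
      = Fintype.card F * ((D.filter fun x => x + z ∈ D).card : ℤ) := by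
  have h : ∀ b, charSum ψ D b ^ 2 * ψ (b * z)
      = ∑ x ∈ D, charSum ψ D b * ψ (b * (x + z)) := by
    intro b
    rw [← Finset.mul_sum, sq, mul_assoc]
    congr 1
    simp only [charSum, Finset.sum_mul, ← AddChar.map_add_eq_mul, ← mul_add]
  simp only [h]
  rw [Finset.sum_comm]
  simp only [sum_charSum_mul hψ]
  rw [← Finset.sum_filter, Finset.sum_const, nsmul_eq_mul, mul_comm]

lemma exists_isSRGWith_of_charSum (hψ : ψ ≠ 1) (D : Finset F) (S : Set F)
    (hS : ∀ x, x ∈ S ↔ x ∈ D) (h0 : (0 : F) ∉ D) (r s : ℤ)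
    (hV : ∀ b, b ≠ 0 → charSum ψ D b = r ∨ charSum ψ D b = s) :
    ∃ l u : ℕ, (SimpleGraph.fromRel (fun x y : F => x - y ∈ S)).IsSRGWith
      (Fintype.card F) D.card l u := by
  set G := SimpleGraph.fromRel (fun x y : F => x - y ∈ S) with hG
  set q := (Fintype.card F : ℤ) with hq
  have hqpos : 0 < q := by
    rw [hq]
    exact_mod_cast Fintype.card_pos
  have hadj : ∀ v w, G.Adj v w ↔ v + w ∈ D := by
    intro v w
    simp only [hG, SimpleGraph.fromRel_adj, hS, CharTwo.sub_eq_add, add_comm w v, or_self]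
    refine ⟨fun h => h.2, fun h => ⟨?_, h⟩⟩
    rintro rfl
    rw [CharTwo.add_self_eq_zero] at h
    exact h0 h
  set k := (D.card : ℤ)
  have hcount : ∀ z, z ≠ 0 → q * ((D.filter fun x => x + z ∈ D).card : ℤ)
      = (r + s) * (if z ∈ D then q else 0) + (k ^ 2 - (r + s) * k + r * s) := by
    intro z hz
    rw [hq, ← sum_charSum_sq_mul hψ, ← sum_charSum_mul hψ, Finset.mul_sum, ← sub_eq_iff_eq_add',
      ← Finset.sum_sub_distrib]
    have h : ∀ b, charSum ψ D b ^ 2 * ψ (b * z) - (r + s) * (charSum ψ D b * ψ (b * z))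
        = (if b = 0 then k ^ 2 - (r + s) * k + r * s else 0) - r * s * ψ (b * z) := by
      intro b
      split_ifs with hb
      · rw [hb, charSum_zero, zero_mul, AddChar.map_zero_eq_one]
        ring
      · rcases hV b hb with h | h <;> rw [h] <;> ring
    simp only [h]
    rw [Finset.sum_sub_distrib, ← Finset.mul_sum,
      AddChar.sum_mulShift _ (AddChar.IsPrimitive.of_ne_one hψ)]
    simp [hz]
  have hcommon : ∀ v w, Fintype.card (G.commonNeighbors v w)
      = (D.filter fun x => x + (v + w) ∈ D).card := by
    intro v w
    rw [Fintype.card_of_subtype ((D.filter fun x => x + (v + w) ∈ D).image (v + ·)),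
      Finset.card_image_of_injective _ (add_right_injective v)]
    intro u
    simp only [Finset.mem_image, Finset.mem_filter, SimpleGraph.mem_commonNeighbors, hadj]
    constructor
    · rintro ⟨x, ⟨h1, h2⟩, rfl⟩
      refine ⟨?_, ?_⟩
      · rwa [← add_assoc, CharTwo.add_self_eq_zero, zero_add]
      · rwa [show w + (v + x) = x + (v + w) by ring]
    · rintro ⟨h1, h2⟩
      refine ⟨v + u, ⟨h1, ?_⟩, ?_⟩
      · rwa [show v + u + (v + w) = (v + v) + (w + u) by ring, CharTwo.add_self_eq_zero, zero_add]
      · rw [← add_assoc, CharTwo.add_self_eq_zero, zero_add]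
  have hdiv : ∀ (c : ℕ) (a : ℤ), q * c = a → c = (a / q).toNat := by
    rintro c a rfl
    rw [Int.mul_ediv_cancel_left _ hqpos.ne', Int.toNat_natCast]
  refine ⟨(((r + s) * q + (k ^ 2 - (r + s) * k + r * s)) / q).toNat,
    ((k ^ 2 - (r + s) * k + r * s) / q).toNat, rfl, ?_, ?_, ?_⟩
  · intro v
    rw [← SimpleGraph.card_neighborFinset_eq_degree,
      show G.neighborFinset v = D.image (v + ·) from ?_,
      Finset.card_image_of_injective _ (add_right_injective v)]
    ext u
    simp only [SimpleGraph.mem_neighborFinset, hadj, Finset.mem_image]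
    constructor
    · intro h
      exact ⟨v + u, h, by rw [← add_assoc, CharTwo.add_self_eq_zero, zero_add]⟩
    · rintro ⟨x, hx, rfl⟩
      rwa [← add_assoc, CharTwo.add_self_eq_zero, zero_add]
  · intro v w hvw
    have hne : v + w ≠ 0 := fun h => hvw.ne (CharTwo.add_eq_zero.mp h)
    rw [hcommon]
    refine hdiv _ _ ?_
    rw [hcount _ hne, if_pos ((hadj v w).mp hvw)]
  · intro v w hne hvw
    have hne : v + w ≠ 0 := fun h => hne (CharTwo.add_eq_zero.mp h)
    rw [hcommon]
    refine hdiv _ _ ?_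
    rw [hcount _ hne, if_neg (fun h => hvw ((hadj v w).mpr h)), mul_zero, zero_add]

/-- Parseval and divisibility force a character sum to take only two values. -/
lemma charSum_two_valued (hψ : ψ ≠ 1) (D : Finset F) (h0 : (0 : F) ∉ D) (d : ℤ)
    (hd : 0 < d)
    (hq : (Fintype.card F : ℤ) = 4 * d ^ 2) (hD : 15 * (D.card : ℤ) + 1 = Fintype.card F)
    (hd15 : d % 15 = 2) (hdvd : ∀ b, b ≠ 0 → d ∣ 15 * charSum ψ D b + 1) :
    ∀ b, b ≠ 0 → charSum ψ D b = (8 * d - 1) / 15 ∨ charSum ψ D b = (-7 * d - 1) / 15 := by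
  have hsum : ∑ b ∈ Finset.univ.erase 0, charSum ψ D b = -D.card := by
    have h := sum_charSum_mul hψ D 0
    simp only [mul_zero, AddChar.map_zero_eq_one, mul_one, if_neg h0] at h
    rw [← Finset.add_sum_erase _ _ (Finset.mem_univ 0), charSum_zero] at h
    linarith
  have hsq : ∑ b ∈ Finset.univ.erase 0, charSum ψ D b ^ 2
      = Fintype.card F * (D.card : ℤ) - (D.card : ℤ) ^ 2 := by
    have h := sum_charSum_sq_mul hψ D 0
    simp only [mul_zero, AddChar.map_zero_eq_one, mul_one, add_zero,
      Finset.filter_true_of_mem (fun _ h => h)] at h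
    rw [← Finset.add_sum_erase _ _ (Finset.mem_univ 0), charSum_zero] at h
    linarith
  have hcard : ((Finset.univ.erase (0 : F)).card : ℤ) = 15 * D.card := by
    rw [Finset.card_erase_of_mem (Finset.mem_univ _), Finset.card_univ,
      Nat.cast_sub Fintype.card_pos, ← hD]
    simp
  have hnonneg : ∀ b ∈ Finset.univ.erase (0 : F),
      0 ≤ (15 * charSum ψ D b + 1 + 7 * d) * (15 * charSum ψ D b + 1 - 8 * d) := by
    intro b hb
    obtain ⟨y, hy⟩ := hdvd b (Finset.ne_of_mem_erase hb)
    have hy15 : y % 15 = 8 := by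
      have h1 : d * y % 15 = 1 := by omega
      rw [Int.mul_emod, hd15] at h1
      omega
    have hy2 : y ≤ -7 ∨ 8 ≤ y := by omega
    rw [hy]
    have : (d * y + 7 * d) * (d * y - 8 * d) = d ^ 2 * ((y + 7) * (y - 8)) := by ring
    rw [this]
    refine mul_nonneg (sq_nonneg d) ?_
    rcases hy2 with h | h <;> nlinarith
  have htotal : ∑ b ∈ Finset.univ.erase (0 : F),
      (15 * charSum ψ D b + 1 + 7 * d) * (15 * charSum ψ D b + 1 - 8 * d) = 0 := by
    have e : ∀ b, (15 * charSum ψ D b + 1 + 7 * d) * (15 * charSum ψ D b + 1 - 8 * d)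
        = 225 * charSum ψ D b ^ 2 + (30 - 15 * d) * charSum ψ D b + (1 + 7 * d) * (1 - 8 * d) :=
      fun b => by ring
    simp only [e]
    rw [Finset.sum_add_distrib, Finset.sum_add_distrib, ← Finset.mul_sum, ← Finset.mul_sum,
      hsum, hsq, Finset.sum_const, nsmul_eq_mul, hcard]
    have h4 : 4 * d ^ 2 = 15 * (D.card : ℤ) + 1 := by rw [hD, hq]
    rw [← hD]
    linear_combination (-210 * (D.card : ℤ)) * h4
  intro b hb
  have h := (Finset.sum_eq_zero_iff_of_nonneg hnonneg).mp htotal b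
    (Finset.mem_erase.mpr ⟨hb, Finset.mem_univ b⟩)
  rcases mul_eq_zero.mp h with h | h <;> omega

end TwoValued

section CyclotomicUnion

variable {F : Type*} [Field F] [Fintype F]

/-- The union of cyclotomic classes, listed by exponents of the primitive element. -/
def classUnion (γ : Fˣ) (n M s : ℕ) : Finset F :=
  (Finset.range n ×ˢ Finset.range M).image fun j => ((γ ^ (3 * j.1 + s + 15 * n * j.2) : Fˣ) : F)

lemma zero_notMem_classUnion (γ : Fˣ) (n M s : ℕ) : (0 : F) ∉ classUnion γ n M s := by
  simp [classUnion]

lemma classUnion_injOn {γ : Fˣ} {n M : ℕ} (s : ℕ) (hγ : orderOf γ = 15 * n * M) :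
    Set.InjOn (fun j : ℕ × ℕ => ((γ ^ (3 * j.1 + s + 15 * n * j.2) : Fˣ) : F))
      (Finset.range n ×ˢ Finset.range M : Finset (ℕ × ℕ)) := by
  have hlt : ∀ i t, i < n → t < M → 3 * i + 15 * n * t < 15 * n * M := by
    intro i t hi ht
    have : 15 * n * (t + 1) ≤ 15 * n * M := Nat.mul_le_mul_left _ ht
    rw [mul_add] at this
    omega
  rintro ⟨i, t⟩ h ⟨i', t'⟩ h' heq
  simp only [Finset.coe_product, Set.mem_prod, Finset.mem_coe, Finset.mem_range] at h h'
  have heq : γ ^ (3 * i + s + 15 * n * t) = γ ^ (3 * i' + s + 15 * n * t') := Units.ext heq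
  rw [add_right_comm, add_right_comm (3 * i'), pow_add _ _ s, pow_add _ _ s] at heq
  have hexp : 3 * i + 15 * n * t = 3 * i' + 15 * n * t' :=
    pow_injOn_Iio_orderOf (by rw [Set.mem_Iio, hγ]; exact hlt i t h.1 h.2)
      (by rw [Set.mem_Iio, hγ]; exact hlt i' t' h'.1 h'.2) (mul_right_cancel heq)
  have hn : 0 < 15 * n := by omega
  have ht : t = t' := by
    have h1 := congrArg (· / (15 * n)) hexp
    simpa [Nat.add_mul_div_left _ _ hn, Nat.div_eq_of_lt (show 3 * i < 15 * n by omega),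
      Nat.div_eq_of_lt (show 3 * i' < 15 * n by omega)] using h1
  subst ht
  simp only [Prod.mk.injEq, and_true]
  omega

lemma card_classUnion {γ : Fˣ} {n M : ℕ} (s : ℕ) (hγ : orderOf γ = 15 * n * M) :
    (classUnion γ n M s).card = n * M := by
  rw [classUnion, Finset.card_image_of_injOn (classUnion_injOn s hγ)]
  simp

lemma mem_classUnion {γ : Fˣ} {n M : ℕ} (s : ℕ) (hM : 0 < M) (hγ : orderOf γ = 15 * n * M)
    (x : F) : x ∈ classUnion γ n M s ↔ ∃ i < n, ∃ t : ℕ, x = (γ : F) ^ (3 * i + s + 15 * n * t) := by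
  simp only [classUnion, Finset.mem_image, Finset.mem_product, Finset.mem_range, Prod.exists]
  constructor
  · rintro ⟨i, t, ⟨hi, -⟩, rfl⟩
    exact ⟨i, hi, t, by simp⟩
  · rintro ⟨i, hi, t, rfl⟩
    refine ⟨i, t % M, ⟨hi, Nat.mod_lt _ hM⟩, ?_⟩
    have h1 : (γ ^ (15 * n)) ^ M = 1 := by rw [← pow_mul, ← hγ, pow_orderOf_eq_one]
    have h2 : (γ ^ (15 * n)) ^ (t % M) = (γ ^ (15 * n)) ^ t := (pow_eq_pow_mod t h1).symm
    rw [pow_add, pow_mul γ (15 * n), h2, ← pow_mul, ← pow_add, Units.val_pow_eq_pow_val]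

variable [CharP F 2]

lemma teichmullerChar_pow_inv_pow_eq_one_iff (γ : Fˣ) (A j : ℕ) :
    ((teichmullerChar F ^ A)⁻¹ (γ : F)) ^ j = 1 ↔ orderOf γ ∣ A * j := by
  have e : ((teichmullerChar F ^ A)⁻¹ (γ : F)) ^ j
      = teichmullerChar F ((γ⁻¹ ^ (A * j) : Fˣ) : F) := by
    rw [MulChar.inv_apply', ← Units.val_inv_eq_inv_val, MulChar.pow_apply_coe, ← pow_mul,
      ← map_pow, Units.val_pow_eq_pow_val]
  rw [e, ← orderOf_inv γ, orderOf_dvd_iff_pow_eq_one]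
  constructor
  · exact fun h => Units.ext (teichmullerChar_eq_one h)
  · intro h
    rw [h, Units.val_one, map_one]

/-- Only characters whose order has trivial or maximal `5`-part see the union of classes, and
their Gauss sums are highly divisible by two. -/
lemma two_pow_dvd_sum_mul_gaussSum {e M : ℕ} (hF : Fintype.card F = 2 ^ (4 * 5 ^ e)) (γ : Fˣ)
    (hγ : orderOf γ = 15 * 5 ^ e * M) (hM : 2 ^ (4 * 5 ^ e) - 1 = 15 * 5 ^ e * M) (s A : ℕ)
    (hA0 : 0 < A) (hA : A < 2 ^ (4 * 5 ^ e) - 1) :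
    (2 : WittVector 2 F) ^ (2 * 5 ^ e - 1) ∣
      (∑ j ∈ Finset.range (5 ^ e) ×ˢ Finset.range M,
        (teichmullerChar F ^ A)⁻¹ ((γ ^ (3 * j.1 + s + 15 * 5 ^ e * j.2) : Fˣ) : F)) *
      gaussSum (teichmullerChar F ^ A) (wittSignChar hF) := by
  have hn : 0 < 5 ^ e := by positivity
  have hMpos : 0 < M := by
    rcases Nat.eq_zero_or_pos M with h0 | h0
    · rw [hM, h0] at hA; simp at hA
    · exact h0
  have hiff := fun j => teichmullerChar_pow_inv_pow_eq_one_iff γ A j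
  rw [hγ] at hiff
  set θ := (teichmullerChar F ^ A)⁻¹ (γ : F) with hθ
  have hsum : ∑ j ∈ Finset.range (5 ^ e) ×ˢ Finset.range M,
        (teichmullerChar F ^ A)⁻¹ ((γ ^ (3 * j.1 + s + 15 * 5 ^ e * j.2) : Fˣ) : F)
      = θ ^ s * ((∑ i ∈ Finset.range (5 ^ e), (θ ^ 3) ^ i)
        * ∑ t ∈ Finset.range M, (θ ^ (15 * 5 ^ e)) ^ t) := by
    rw [Finset.sum_mul_sum, ← Finset.sum_product', Finset.mul_sum]
    refine Finset.sum_congr rfl fun j _ => ?_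
    rw [Units.val_pow_eq_pow_val, map_pow, ← hθ]
    ring
  rw [hsum]
  by_cases h1 : θ ^ (15 * 5 ^ e) = 1
  swap
  · rw [geom_sum_eq_zero_of_pow_eq_one (k := M) _ h1]
    · simp
    · rw [← pow_mul, hiff]
      exact dvd_mul_left _ _
  obtain ⟨c, rfl⟩ : M ∣ A := by
    have h := (hiff _).mp h1
    rw [mul_comm A] at h
    exact Nat.dvd_of_mul_dvd_mul_left (by positivity) h
  by_cases h2 : θ ^ 3 ≠ 1 ∧ (θ ^ 3) ^ 5 ^ e = 1
  · rw [geom_sum_eq_zero_of_pow_eq_one h2.2 h2.1]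
    simp
  refine Dvd.dvd.mul_left ?_ _
  have hc : ¬ 5 ∣ c ∨ 5 ^ (e + 1) ∣ c := by
    rw [← pow_mul, hiff, Ne, hiff] at h2
    by_contra! hcon
    refine h2 ⟨fun h => hcon.2 ?_, ?_⟩
    · have h : 3 * M * 5 ^ (e + 1) ∣ 3 * M * c := by
        convert h using 1 <;> ring
      exact Nat.dvd_of_mul_dvd_mul_left (by positivity) h
    · obtain ⟨c', rfl⟩ := hcon.1
      exact ⟨c', by ring⟩
  have hw := binaryWeight_le e (M * c) c M hM (mul_comm _ _) hA hc
  have hpow : ∀ j, 0 < j → j ≤ M * c → (teichmullerChar F)⁻¹ ^ j ≠ 1 := by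
    intro j hj hjA h
    have h' := (teichmullerChar_pow_inv_pow_eq_one_iff γ j 1).mp (by
      rw [← inv_pow, h, MulChar.one_apply_coe, pow_one])
    rw [hγ, mul_one] at h'
    have := Nat.le_of_dvd hj h'
    omega
  have hf : 0 < 4 * 5 ^ e := by positivity
  have h := two_pow_dvd_gaussSum (teichmullerChar F)⁻¹ (wittSignChar hF)
    (fun x => by rw [wittSignChar_apply, wittSignChar_apply, signChar_sq])
    (wittSignChar_ne_one hF hf)
    (gaussSum_teichmullerChar_inv_dvd_two hF hf (by simpa using hpow 1 one_pos hA0))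
    wittVector_two_ne_zero (4 * 5 ^ e) (M * c) (2 * 5 ^ e - 1) hF (by omega) hA0 hpow (by omega)
  rwa [inv_pow, inv_inv] at h

lemma two_pow_dvd_charSum {e M : ℕ} (hF : Fintype.card F = 2 ^ (4 * 5 ^ e)) (γ : Fˣ)
    (hγ : orderOf γ = 15 * 5 ^ e * M) (hM : 2 ^ (4 * 5 ^ e) - 1 = 15 * 5 ^ e * M) (s : ℕ)
    (b : F) (hb : b ≠ 0) :
    (2 : ℤ) ^ (2 * 5 ^ e - 1) ∣ 15 * charSum (signChar hF) (classUnion γ (5 ^ e) M s) b + 1 := by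
  have hf : 0 < 4 * 5 ^ e := by positivity
  have hV : (2 : ℤ) ^ (2 * 5 ^ e - 1) ∣ ((5 ^ e * M : ℕ) : ℤ) *
      (15 * charSum (signChar hF) (classUnion γ (5 ^ e) M s) b + 1) := by
    apply two_pow_dvd_of_wittVector (F := F)
    have h := card_sub_one_mul_sum_eq (teichmullerChar F) (fun _ => teichmullerChar_eq_one)
      (wittSignChar hF) (wittSignChar_ne_one hF hf) (Finset.range (5 ^ e) ×ˢ Finset.range M)
      (fun j => γ ^ (3 * j.1 + s + 15 * 5 ^ e * j.2)) (Units.mk0 b hb)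
    have hdvd : (2 : WittVector 2 F) ^ (2 * 5 ^ e - 1) ∣ _ :=
      h ▸ Finset.dvd_sum fun A hA => Dvd.dvd.mul_left
        (two_pow_dvd_sum_mul_gaussSum hF γ hγ hM s A (Finset.mem_Ico.mp hA).1
          (hF ▸ (Finset.mem_Ico.mp hA).2)) _
    convert hdvd using 1
    rw [hF, hM, charSum, classUnion, Finset.sum_image (classUnion_injOn s hγ)]
    simp only [wittSignChar_apply, Units.val_mk0, Finset.card_product, Finset.card_range]
    push_cast
    ring
  have hodd : ¬ 2 ∣ 5 ^ e * M := by
    intro h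
    have h1 : 2 ∣ 15 * 5 ^ e * M := by
      rw [mul_assoc]
      exact h.mul_left _
    have h2 : 2 ∣ 2 ^ (4 * 5 ^ e) := dvd_pow_self 2 hf.ne'
    have h3 : 0 < 2 ^ (4 * 5 ^ e) := by positivity
    rw [← hM] at h1
    omega
  refine IsCoprime.dvd_of_dvd_mul_left (IsCoprime.pow_left ?_) hV
  have := (Nat.Prime.coprime_iff_not_dvd Nat.prime_two).mpr hodd
  exact_mod_cast Nat.isCoprime_iff_coprime.mpr this

end CyclotomicUnion

/-- Each `Cay(F_q, D_k)` is a strongly regular graph of degree `(q-1)/15`,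
where `q = 2^{4*5^(m-1)}`, `N = 5^m*3`. -/
theorem cayley_srg_example_9
    (m N q : ℕ) (hm : 1 ≤ m)
    (hN : N = 5 ^ m * 3) (hq : q = 2 ^ (4 * 5 ^ (m - 1)))
    (F : Type) [Field F] [Fintype F] (hF : Fintype.card F = q)
    (γ : Fˣ) (hγ : orderOf γ = q - 1)
    (D : ℕ → Set F)
    (hD : ∀ k, D k = {x : F | ∃ i < 5 ^ (m - 1), ∃ t : ℕ,
        x = ((γ : F)) ^ (3 * i + k * 5 ^ (m - 1) + N * t)}) :
    ∀ k ≤ 14,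
      SimpleGraph.fromRel (fun x y : F => x - y ∈ D k) ≠ ⊤ ∧
      SimpleGraph.fromRel (fun x y : F => x - y ∈ D k) ≠ ⊥ ∧
      ∃ l u : ℕ, (SimpleGraph.fromRel (fun x y : F => x - y ∈ D k)).IsSRGWith
        q ((q - 1) / 15) l u := by
  obtain ⟨e, rfl⟩ : ∃ e, m = e + 1 := ⟨m - 1, by omega⟩
  simp only [Nat.add_sub_cancel] at hq hD
  have hcard : Fintype.card F = 2 ^ (4 * 5 ^ e) := hF.trans hq
  have : Fact (Nat.Prime 2) := ⟨Nat.prime_two⟩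
  have : CharP F 2 := charP_of_card_eq_prime_pow hcard
  have hn : 0 < 5 ^ e := by positivity
  obtain ⟨M, hM⟩ : ∃ M, 2 ^ (4 * 5 ^ e) - 1 = 15 * 5 ^ e * M := by
    obtain ⟨u, hu⟩ := exists_sixteen_pow e
    refine ⟨1 + 5 * u, ?_⟩
    rw [pow_mul, show (2 : ℕ) ^ 4 = 16 by norm_num, hu]
    simp
  have hqpos : 1 < 2 ^ (4 * 5 ^ e) := Nat.one_lt_two_pow (by positivity)
  have hMpos : 0 < M := by
    rcases Nat.eq_zero_or_pos M with h0 | h0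
    · rw [h0] at hM
      omega
    · exact h0
  have hN' : N = 15 * 5 ^ e := by rw [hN]; ring
  rw [hq, hM] at hγ
  intro k _
  set E := classUnion γ (5 ^ e) M (k * 5 ^ e) with hE
  have hS : ∀ x, x ∈ D k ↔ x ∈ E := by
    intro x
    rw [hE, mem_classUnion _ hMpos hγ, hD, hN']
    rfl
  have h0 : (0 : F) ∉ E := zero_notMem_classUnion _ _ _ _
  have hEcard : E.card = 5 ^ e * M := card_classUnion _ hγ
  have hEpos : 0 < E.card := by rw [hEcard]; positivity
  have hqE : 15 * E.card + 1 = Fintype.card F := by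
    rw [hEcard, hcard, ← mul_assoc, ← hM]
    omega
  have hdeg : (q - 1) / 15 = E.card := by
    rw [← hF, ← hqE]
    omega
  refine ⟨fun h => ?_, fun h => ?_, ?_⟩
  · obtain ⟨x, -, hx⟩ := Finset.exists_mem_notMem_of_card_lt_card
      (s := insert 0 E) (t := Finset.univ) (by
        rw [Finset.card_insert_of_notMem h0, Finset.card_univ]
        omega)
    rw [Finset.mem_insert, not_or] at hx
    have hadj := (SimpleGraph.top_adj x 0).mpr hx.1
    rw [← h, SimpleGraph.fromRel_adj, hS, hS, sub_zero, zero_sub, CharTwo.neg_eq, or_self] at hadj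
    exact hx.2 hadj.2
  · obtain ⟨x, hx⟩ := Finset.card_pos.mp hEpos
    have hadj : (SimpleGraph.fromRel (fun x y : F => x - y ∈ D k)).Adj x 0 := by
      rw [SimpleGraph.fromRel_adj, hS, sub_zero]
      exact ⟨fun h => h0 (h ▸ hx), Or.inl hx⟩
    rw [h] at hadj
    exact hadj
  · rw [hdeg, ← hF]
    have hψ := signChar_ne_one hcard (by positivity)
    obtain ⟨j, hj⟩ : ∃ j, 5 ^ e = 2 * j + 1 := (Odd.pow (by decide) : Odd (5 ^ e))
    refine exists_isSRGWith_of_charSum hψ E (D k) hS h0 _ _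
      (charSum_two_valued hψ E h0 (2 ^ (2 * 5 ^ e - 1)) (by positivity) ?_
        (by exact_mod_cast hqE) ?_ (two_pow_dvd_charSum hcard γ hγ hM _))
    · rw [hcard]
      push_cast
      rw [← pow_mul, show (4 : ℤ) = 2 ^ 2 by norm_num, ← pow_add]
      congr 1
      omega
    · rw [show 2 * 5 ^ e - 1 = 4 * j + 1 by omega, pow_succ, pow_mul, Int.mul_emod]
      have : ((2 : ℤ) ^ 4) ^ j % 15 = 1 := by
        rw [← Int.emod_emod_of_dvd _ (dvd_refl 15)]
        exact ((Int.ModEq.pow j (show (2 : ℤ) ^ 4 ≡ 1 [ZMOD 15] by decide)).trans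
          (by rw [one_pow])) ▸ rfl
      rw [this]
      norm_num
end
end
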